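/- arXiv:0907.3295 — 3 statements merged into one kernel-verified Lean document; each statement's English description precedes it below -/
import Mathlib

section
/- Let E ⊆ H be precisely monotone, and suppose E and H∖E are both nonempty. Then the topological frontier ∂E is a plane, and C ⊆ E ⊆ closure(C) for one of the two connected components C of H∖∂E. -/
open MeasureTheory Set Topology Filter

noncomputable section

/-- The Heisenberg group as a set: `ℝ³`. -/
abbrev Heis : Type := ℝ × ℝ × ℝ

/-- The Heisenberg group multiplication
`(a,b,c)·(a',b',c') = (a+a', b+b', c+c'+a·b')`. -/
def hMul (x y : Heis) : Heis :=
  (x.1 + y.1, x.2.1 + y.2.1, x.2.2 + y.2.2 + x.1 * y.2.1)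

/-- The abelianization homomorphism `π : H → ℝ²`, `π(a,b,c) = (a,b)`. -/
def hPi (x : Heis) : ℝ × ℝ := (x.1, x.2.1)

/-- The (horizontal) line of the Heisenberg group through `g` with direction `(a,b)`:
`{g·(ta, tb, t²ab/2) : t ∈ ℝ}`. -/
def hLine (g : Heis) (a b : ℝ) : Set Heis :=
  {p | ∃ t : ℝ, p = hMul g (t * a, t * b, t ^ 2 * a * b / 2)}

/-- A subset of the Heisenberg group is a (horizontal) line. -/
def IsLine (L : Set Heis) : Prop :=
  ∃ g : Heis, ∃ a b : ℝ, ¬(a = 0 ∧ b = 0) ∧ L = hLine g a b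

/-- Two lines of `H` are parallel if their `π`-images are parallel straight lines
in `ℝ²`, i.e. their direction vectors are linearly dependent. -/
def AreParallelLines (L₁ L₂ : Set Heis) : Prop :=
  ∃ g₁ g₂ : Heis, ∃ a₁ b₁ a₂ b₂ : ℝ,
    ¬(a₁ = 0 ∧ b₁ = 0) ∧ ¬(a₂ = 0 ∧ b₂ = 0) ∧
    L₁ = hLine g₁ a₁ b₁ ∧ L₂ = hLine g₂ a₂ b₂ ∧ a₁ * b₂ = a₂ * b₁

/-- Two lines of `H` are skew if they are disjoint and not parallel. -/
def AreSkewLines (L₁ L₂ : Set Heis) : Prop :=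
  IsLine L₁ ∧ IsLine L₂ ∧ Disjoint L₁ L₂ ∧ ¬ AreParallelLines L₁ L₂

/-- A straight line in `ℝ²`. -/
def IsLineR2 (l : Set (ℝ × ℝ)) : Prop :=
  ∃ p v : ℝ × ℝ, v ≠ 0 ∧ l = {q | ∃ t : ℝ, q = p + t • v}

/-- The horizontal plane centered at `g`: the union of all lines through `g`. -/
def horizPlane (g : Heis) : Set Heis :=
  {p | ∃ L : Set Heis, IsLine L ∧ g ∈ L ∧ p ∈ L}

/-- A plane of the Heisenberg group: a vertical plane `π⁻¹(ℓ)` for a straight line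
`ℓ ⊂ ℝ²`, or a horizontal plane. -/
def IsPlane (P : Set Heis) : Prop :=
  (∃ l : Set (ℝ × ℝ), IsLineR2 l ∧ P = hPi ⁻¹' l) ∨ (∃ g : Heis, P = horizPlane g)

/-- A half-space of the Heisenberg group: a connected component of the complement
of a plane. -/
def IsHalfSpace (C : Set Heis) : Prop :=
  ∃ P : Set Heis, ∃ x : Heis, IsPlane P ∧ x ∉ P ∧ C = connectedComponentIn Pᶜ x

/-- A subset `E` of the Heisenberg group is precisely monotone if every line
intersects both `E` and its complement in connected sets. -/
def IsPreciselyMonotone (E : Set Heis) : Prop :=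
  ∀ L : Set Heis, IsLine L → IsPreconnected (L ∩ E) ∧ IsPreconnected (L ∩ Eᶜ)

/-- In the coordinates `(x, y, w) = (a, b, 2 * c - a * b)` two points lie on a common horizontal
line if and only if `horForm` vanishes on them. -/
def horForm (p q : Heis) : ℝ := q.2.2 - p.2.2 - (p.1 * q.2.1 - p.2.1 * q.1)

lemma horForm_swap (p q : Heis) : horForm q p = -horForm p q := by
  simp only [horForm]; ring

lemma horForm_self (p : Heis) : horForm p p = 0 := by
  simp only [horForm]; ring

lemma horForm_segment (r p q : Heis) (t : ℝ) :
    horForm r (p + t • (q - p)) = (1 - t) * horForm r p + t * horForm r q := by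
  simp only [horForm, Prod.fst_add, Prod.snd_add, Prod.smul_fst, Prod.smul_snd, Prod.fst_sub,
    Prod.snd_sub, smul_eq_mul]
  ring

lemma continuous_horForm : Continuous fun x : Heis × Heis => horForm x.1 x.2 := by
  unfold horForm; fun_prop

lemma eq_of_horForm_eq_zero {p q : Heis} (h : horForm p q = 0) (h1 : p.1 = q.1)
    (h2 : p.2.1 = q.2.1) : p = q := by
  refine Prod.ext h1 (Prod.ext h2 ?_)
  simp only [horForm, h1, h2] at h
  linarith

/-- Convexity along horizontal lines. -/
def HorConvex (A : Set Heis) : Prop :=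
  ∀ p ∈ A, ∀ q ∈ A, horForm p q = 0 → ∀ t : ℝ, 0 ≤ t → t ≤ 1 → p + t • (q - p) ∈ A

/-- The horizontal line through `p` over the direction `v`, in the coordinates `(x, y, w)`. -/
def horLine (p : Heis) (v : ℝ × ℝ) (t : ℝ) : Heis :=
  (p.1 + t * v.1, p.2.1 + t * v.2, p.2.2 + t * (p.1 * v.2 - p.2.1 * v.1))

lemma horLine_zero (p : Heis) (v : ℝ × ℝ) : horLine p v 0 = p := by
  simp [horLine]

lemma horLine_neg (p : Heis) (v : ℝ × ℝ) (t : ℝ) : horLine p (-v) t = horLine p v (-t) := by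
  simp only [horLine, Prod.fst_neg, Prod.snd_neg]
  refine Prod.ext ?_ (Prod.ext ?_ ?_) <;> ring

lemma horForm_horLine (p : Heis) (v : ℝ × ℝ) (s t : ℝ) :
    horForm (horLine p v s) (horLine p v t) = 0 := by
  simp only [horForm, horLine]; ring

lemma horLine_segment (p : Heis) (v : ℝ × ℝ) (s t r : ℝ) :
    horLine p v s + r • (horLine p v t - horLine p v s) = horLine p v (s + r * (t - s)) := by
  simp only [horLine]
  refine Prod.ext ?_ (Prod.ext ?_ ?_) <;> simp <;> ring

lemma horLine_sub {p q : Heis} (h : horForm p q = 0) (t : ℝ) :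
    horLine p (q.1 - p.1, q.2.1 - p.2.1) t = p + t • (q - p) := by
  simp only [horForm] at h
  refine Prod.ext ?_ (Prod.ext ?_ ?_) <;> simp [horLine]
  left; linarith

/-- Closedness under taking the horizontal line through two distinct points. -/
def LineClosed (S : Set Heis) : Prop :=
  ∀ (p : Heis) (v : ℝ × ℝ) (s r : ℝ), horLine p v s ∈ S → horLine p v r ∈ S → s ≠ r →
    ∀ t, horLine p v t ∈ S

lemma LineClosed.mem_of_segment {S : Set Heis} (hS : LineClosed S) {p q : Heis} (hp : p ∈ S)
    (hq : q ∈ S) (h : horForm p q = 0) (t : ℝ) : p + t • (q - p) ∈ S := by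
  rw [← horLine_sub h]
  refine hS p _ 0 1 (by rwa [horLine_zero]) ?_ zero_ne_one t
  rwa [horLine_sub h, one_smul, add_sub_cancel]

/-- A point horizontally related to both `r` and `q`, close to their midpoint when `r` and `q` are
nearly horizontally related. -/
def transversalPoint (r q : Heis) : Heis :=
  let n := (r.1 - q.1) ^ 2 + (r.2.1 - q.2.1) ^ 2
  let e₁ := -(horForm r q * (r.2.1 - q.2.1) / n)
  let e₂ := horForm r q * (r.1 - q.1) / n
  ((r.1 + q.1) / 2 + e₁, (r.2.1 + q.2.1) / 2 + e₂,
    (r.2.2 + q.2.2) / 2 + (r.1 * e₂ - r.2.1 * e₁) - horForm r q / 2)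

lemma horForm_transversalPoint_left (r q : Heis) : horForm r (transversalPoint r q) = 0 := by
  simp only [transversalPoint, horForm]; ring

lemma horForm_transversalPoint_right {r q : Heis}
    (h : (r.1 - q.1) ^ 2 + (r.2.1 - q.2.1) ^ 2 ≠ 0) :
    horForm q (transversalPoint r q) = 0 := by
  have key : horForm q (transversalPoint r q) = -horForm r q +
      horForm r q * ((r.1 - q.1) ^ 2 + (r.2.1 - q.2.1) ^ 2) /
        ((r.1 - q.1) ^ 2 + (r.2.1 - q.2.1) ^ 2) := by
    simp only [transversalPoint, horForm]
    ring
  rw [key, mul_div_cancel_right₀ _ h]; ring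

lemma transversalPoint_of_horForm_eq_zero {r q : Heis} (h : horForm r q = 0) :
    transversalPoint r q = ((r.1 + q.1) / 2, (r.2.1 + q.2.1) / 2, (r.2.2 + q.2.2) / 2) := by
  simp [transversalPoint, h]

lemma continuousAt_transversalPoint {r q : Heis}
    (h : (r.1 - q.1) ^ 2 + (r.2.1 - q.2.1) ^ 2 ≠ 0) :
    ContinuousAt (fun x : Heis × Heis => transversalPoint x.1 x.2) (r, q) := by
  have h1 : ContinuousAt (fun x : Heis × Heis => horForm x.1 x.2) (r, q) :=
    continuous_horForm.continuousAt
  have h2 : ContinuousAt (fun x : Heis × Heis =>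
      (x.1.1 - x.2.1) ^ 2 + (x.1.2.1 - x.2.2.1) ^ 2) (r, q) := by fun_prop
  unfold transversalPoint
  fun_prop (disch := exact h)

/-- A horizontal segment from an interior point to a point of the closure stays in the interior. -/
lemma HorConvex.segment_mem_interior {A : Set Heis} (hA : HorConvex A) {a b : Heis}
    (ha : a ∈ interior A) (hb : b ∈ closure A) (hab : horForm a b = 0) {t : ℝ} (ht0 : 0 ≤ t)
    (ht1 : t < 1) : a + t • (b - a) ∈ interior A := by
  rcases eq_or_ne a b with rfl | hne
  · simpa using ha
  rcases ht0.eq_or_lt with rfl | ht0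
  · simpa using ha
  set q := a + t • (b - a) with hq
  have hs : 0 < 1 - t := by linarith
  have hn : (b.1 - q.1) ^ 2 + (b.2.1 - q.2.1) ^ 2 ≠ 0 := by
    have e : (b.1 - q.1) ^ 2 + (b.2.1 - q.2.1) ^ 2 =
        (1 - t) ^ 2 * ((b.1 - a.1) ^ 2 + (b.2.1 - a.2.1) ^ 2) := by
      simp [hq]; ring
    rw [e]
    refine mul_ne_zero (pow_ne_zero _ hs.ne') fun h0 => hne (eq_of_horForm_eq_zero hab ?_ ?_)
    · nlinarith [sq_nonneg (b.1 - a.1), sq_nonneg (b.2.1 - a.2.1)]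
    · nlinarith [sq_nonneg (b.1 - a.1), sq_nonneg (b.2.1 - a.2.1)]
  have hbq : horForm b q = 0 := by
    rw [hq, horForm_segment, horForm_self, horForm_swap, hab]; ring
  have hy := transversalPoint_of_horForm_eq_zero hbq
  have hcont := continuousAt_transversalPoint hn
  set k : ℝ := 2 / (1 - t) with hk
  set l : ℝ := (1 + t) / (1 - t) with hl
  have hk1 : 1 < k := by rw [hk, lt_div_iff₀ hs]; linarith
  have hl1 : 1 < l := by rw [hl, lt_div_iff₀ hs]; linarith
  have ev1 : ∀ᶠ x : Heis × Heis in 𝓝 (b, q),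
      x.1 + k • (transversalPoint x.1 x.2 - x.1) ∈ interior A := by
    have : ContinuousAt (fun x : Heis × Heis =>
      x.1 + k • (transversalPoint x.1 x.2 - x.1)) (b, q) := by fun_prop
    refine this.eventually_mem ?_
    convert isOpen_interior.mem_nhds ha using 2
    simp only [hy]
    simp only [hq, hk]
    refine Prod.ext ?_ (Prod.ext ?_ ?_) <;> simp <;> field_simp <;> ring
  have ev2 : ∀ᶠ x : Heis × Heis in 𝓝 (b, q),
      transversalPoint x.1 x.2 + l • (x.2 - transversalPoint x.1 x.2) ∈ interior A := by
    have : ContinuousAt (fun x : Heis × Heis =>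
      transversalPoint x.1 x.2 + l • (x.2 - transversalPoint x.1 x.2)) (b, q) := by fun_prop
    refine this.eventually_mem ?_
    convert isOpen_interior.mem_nhds ha using 2
    simp only [hy]
    simp only [hq, hl]
    refine Prod.ext ?_ (Prod.ext ?_ ?_) <;> simp <;> field_simp <;> ring
  have ev3 : ∀ᶠ x : Heis × Heis in 𝓝 (b, q),
      (x.1.1 - x.2.1) ^ 2 + (x.1.2.1 - x.2.2.1) ^ 2 ≠ 0 := by
    have : ContinuousAt (fun x : Heis × Heis =>
      (x.1.1 - x.2.1) ^ 2 + (x.1.2.1 - x.2.2.1) ^ 2) (b, q) := by fun_prop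
    exact this.eventually_ne hn
  obtain ⟨U, hU, W, hW, hUW⟩ := mem_nhds_prod_iff.1 ((ev1.and (ev2.and ev3)))
  obtain ⟨r, hrU, hrA⟩ := mem_closure_iff_nhds.1 hb U hU
  refine mem_interior_iff_mem_nhds.2 (mem_of_superset hW fun q' hq' => ?_)
  obtain ⟨h1, h2, h3⟩ := hUW (mk_mem_prod hrU hq')
  simp only at h1 h2 h3
  have hry := horForm_transversalPoint_left r q'
  have hqy := horForm_transversalPoint_right h3
  set y := transversalPoint r q'
  have hyA : y ∈ A := by
    have := hA r hrA _ (interior_subset h1) (by rw [horForm_segment, horForm_self, hry]; ring)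
      k⁻¹ (by positivity) (inv_le_one_of_one_le₀ hk1.le)
    rwa [add_sub_cancel_left, smul_smul, inv_mul_cancel₀ (by positivity), one_smul,
      add_sub_cancel] at this
  have := hA y hyA _ (interior_subset h2)
    (by rw [horForm_segment, horForm_self, horForm_swap, hqy]; ring) l⁻¹ (by positivity)
    (inv_le_one_of_one_le₀ hl1.le)
  rwa [add_sub_cancel_left, smul_smul, inv_mul_cancel₀ (by positivity), one_smul,
    add_sub_cancel] at this

lemma HorConvex.horLine_mem_interior {A : Set Heis} (hA : HorConvex A) {p : Heis} {v : ℝ × ℝ}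
    {t s u : ℝ} (ht : horLine p v t ∈ interior A) (hs : horLine p v s ∈ closure A)
    (hu : (t < u ∧ u < s) ∨ (s < u ∧ u < t)) : horLine p v u ∈ interior A := by
  have hst : s - t ≠ 0 := by rcases hu with h | h <;> [skip; skip] <;> intro h' <;> linarith
  have h := hA.segment_mem_interior ht hs (horForm_horLine _ _ _ _) (t := (u - t) / (s - t))
    (by rcases hu with h | h
        · exact div_nonneg (by linarith) (by linarith)
        · exact div_nonneg_of_nonpos (by linarith) (by linarith))
    (by rcases hu with h | h
        · rw [div_lt_one (by linarith)]; linarith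
        · rw [div_lt_one_of_neg (by linarith)]; linarith)
  rwa [horLine_segment, div_mul_cancel₀ _ hst, add_sub_cancel] at h

lemma mem_interior_or_of_notMem_frontier {X : Type*} [TopologicalSpace X] {A : Set X} {x : X}
    (h : x ∉ frontier A) : x ∈ interior A ∨ x ∈ interior Aᶜ := by
  rw [interior_compl]
  by_contra! h'
  exact h ⟨not_notMem.1 h'.2, h'.1⟩

lemma HorConvex.horLine_notMem_interior {A : Set Heis} (hA : HorConvex A) (hB : HorConvex Aᶜ)
    {p : Heis} {v : ℝ × ℝ} {s r t : ℝ} (hs : horLine p v s ∈ frontier A)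
    (hr : horLine p v r ∈ frontier A) (hsr : s < r) : horLine p v t ∉ interior A := by
  intro ht
  rcases lt_trichotomy t s with h | rfl | h
  · exact hs.2 (hA.horLine_mem_interior ht hr.1 (.inl ⟨h, hsr⟩))
  · exact hs.2 ht
  rcases lt_trichotomy t r with h' | rfl | h'
  · have hl : horLine p v (s - 1) ∈ interior Aᶜ := by
      rw [interior_compl]
      exact fun hc => hs.2 (hA.horLine_mem_interior ht hc (.inr ⟨by linarith, h⟩))
    have hg : horLine p v (r + 1) ∈ interior Aᶜ := by
      rw [interior_compl]
      exact fun hc => hr.2 (hA.horLine_mem_interior ht hc (.inl ⟨h', by linarith⟩))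
    have := hB.horLine_mem_interior hl (subset_closure (interior_subset hg)) (u := t)
      (.inl ⟨by linarith, by linarith⟩)
    exact interior_subset this (interior_subset ht)
  · exact hr.2 ht
  · exact hr.2 (hA.horLine_mem_interior ht hs.1 (.inr ⟨hsr, h'⟩))

lemma HorConvex.lineClosed_frontier {A : Set Heis} (hA : HorConvex A) (hB : HorConvex Aᶜ) :
    LineClosed (frontier A) := by
  intro p v s r hs hr hsr t
  wlog h : s < r generalizing s r
  · exact this r s hr hs hsr.symm (lt_of_le_of_ne (not_lt.1 h) hsr.symm)
  by_contra hc
  rcases mem_interior_or_of_notMem_frontier hc with hc | hc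
  · exact hA.horLine_notMem_interior hB hs hr h hc
  · rw [← frontier_compl] at hs hr
    exact hB.horLine_notMem_interior (by rwa [compl_compl]) hs hr h hc

lemma HorConvex.reflect_mem_interior {A : Set Heis} (hA : HorConvex A) {p : Heis} {v : ℝ × ℝ}
    (hp : p ∈ frontier A) (hv : horLine p v 1 ∈ interior A) :
    horLine p (-v) 1 ∈ interior Aᶜ := by
  rw [interior_compl, horLine_neg]
  intro hc
  have := hA.horLine_mem_interior hv hc (u := 0) (.inr ⟨by norm_num, by norm_num⟩)
  rw [horLine_zero] at this
  exact hp.2 this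

lemma HorConvex.exists_horLine_subset_frontier {A : Set Heis} (hA : HorConvex A)
    (hB : HorConvex Aᶜ) {p : Heis} (hp : p ∈ frontier A) :
    ∃ v : ℝ × ℝ, v ≠ 0 ∧ ∀ t, horLine p v t ∈ frontier A := by
  by_contra! hcon
  have hout : ∀ v : ℝ × ℝ, v ≠ 0 → horLine p v 1 ∈ interior A ∨ horLine p v 1 ∈ interior Aᶜ := by
    intro v hv
    refine mem_interior_or_of_notMem_frontier fun h1 => ?_
    obtain ⟨t, ht⟩ := hcon v hv
    exact ht (hA.lineClosed_frontier hB p v 0 1 (by rwa [horLine_zero]) h1 zero_ne_one t)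
  have hconn : IsPreconnected ({0}ᶜ : Set (ℝ × ℝ)) :=
    (isConnected_compl_singleton_of_one_lt_rank
      (by rw [rank_prod', Module.rank_self, one_add_one_eq_two]; exact Cardinal.one_lt_two)
      0).isPreconnected
  have hcont : Continuous fun v : ℝ × ℝ => horLine p v 1 := by unfold horLine; fun_prop
  have hswap : ∀ v : ℝ × ℝ, horLine p v 1 ∈ interior Aᶜ → horLine p (-v) 1 ∈ interior A := by
    intro v hv
    have := hB.reflect_mem_interior (by rwa [frontier_compl]) hv
    rwa [compl_compl] at this
  have h0 : ((1, 0) : ℝ × ℝ) ≠ 0 := by simp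
  have hne : (∃ v : ℝ × ℝ, v ≠ 0 ∧ horLine p v 1 ∈ interior A) ∧
      ∃ v : ℝ × ℝ, v ≠ 0 ∧ horLine p v 1 ∈ interior Aᶜ := by
    rcases hout _ h0 with h | h
    · exact ⟨⟨_, h0, h⟩, ⟨_, neg_ne_zero.2 h0, hA.reflect_mem_interior hp h⟩⟩
    · exact ⟨⟨_, neg_ne_zero.2 h0, hswap _ h⟩, ⟨_, h0, h⟩⟩
  obtain ⟨⟨v, hv, hvA⟩, ⟨v', hv', hvB⟩⟩ := hne
  obtain ⟨u, -, huA, huB⟩ := hconn _ _ (isOpen_interior.preimage hcont)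
    (isOpen_interior.preimage hcont) (fun v hv => hout v hv) ⟨v, hv, hvA⟩ ⟨v', hv', hvB⟩
  exact interior_subset huB (interior_subset huA)

/-- The affine coordinate change sending the origin to `p` and the first two coordinate axes to the
horizontal lines through `p` over `v` and `v'`. It rescales `horForm` by the determinant
of `v, v'`. -/
def horFrame (p : Heis) (v v' : ℝ × ℝ) (x : Heis) : Heis :=
  (p.1 + x.1 * v.1 + x.2.1 * v'.1, p.2.1 + x.1 * v.2 + x.2.1 * v'.2,
    p.2.2 + x.1 * (p.1 * v.2 - p.2.1 * v.1) + x.2.1 * (p.1 * v'.2 - p.2.1 * v'.1) +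
      (v.1 * v'.2 - v.2 * v'.1) * x.2.2)

lemma continuous_horFrame (p : Heis) (v v' : ℝ × ℝ) : Continuous (horFrame p v v') := by
  unfold horFrame; fun_prop

lemma horForm_horFrame (p : Heis) (v v' : ℝ × ℝ) (x y : Heis) :
    horForm (horFrame p v v' x) (horFrame p v v' y) =
      (v.1 * v'.2 - v.2 * v'.1) * horForm x y := by
  simp only [horForm, horFrame]; ring

lemma horFrame_segment (p : Heis) (v v' : ℝ × ℝ) (x y : Heis) (t : ℝ) :
    horFrame p v v' (x + t • (y - x)) =
      horFrame p v v' x + t • (horFrame p v v' y - horFrame p v v' x) := by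
  refine Prod.ext ?_ (Prod.ext ?_ ?_) <;> simp [horFrame] <;> ring

lemma horFrame_horLine (p : Heis) (v v' : ℝ × ℝ) (x : Heis) (u : ℝ × ℝ) (t : ℝ) :
    horFrame p v v' (horLine x u t) =
      horLine (horFrame p v v' x) (u.1 * v.1 + u.2 * v'.1, u.1 * v.2 + u.2 * v'.2) t := by
  refine Prod.ext ?_ (Prod.ext ?_ ?_) <;> simp only [horFrame, horLine] <;> ring

/-- The inverse of `horFrame`. -/
def horFrameInv (p : Heis) (v v' : ℝ × ℝ) (q : Heis) : Heis :=
  let x := ((q.1 - p.1) * v'.2 - (q.2.1 - p.2.1) * v'.1) / (v.1 * v'.2 - v.2 * v'.1)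
  let y := (v.1 * (q.2.1 - p.2.1) - v.2 * (q.1 - p.1)) / (v.1 * v'.2 - v.2 * v'.1)
  (x, y, (q.2.2 - p.2.2 - x * (p.1 * v.2 - p.2.1 * v.1) -
    y * (p.1 * v'.2 - p.2.1 * v'.1)) / (v.1 * v'.2 - v.2 * v'.1))

lemma continuous_horFrameInv (p : Heis) (v v' : ℝ × ℝ) : Continuous (horFrameInv p v v') := by
  unfold horFrameInv; fun_prop

lemma horFrame_horFrameInv (p : Heis) {v v' : ℝ × ℝ} (h : v.1 * v'.2 - v.2 * v'.1 ≠ 0)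
    (q : Heis) : horFrame p v v' (horFrameInv p v v' q) = q := by
  simp only [horFrame, horFrameInv]
  obtain ⟨d, hd⟩ : ∃ d, d = v.1 * v'.2 - v.2 * v'.1 := ⟨_, rfl⟩
  rw [← hd] at h ⊢
  refine Prod.ext ?_ (Prod.ext ?_ ?_) <;> simp only <;> field_simp <;> rw [hd] <;> ring

lemma LineClosed.preimage_horFrame {S : Set Heis} (hS : LineClosed S) (p : Heis) (v v' : ℝ × ℝ) :
    LineClosed (horFrame p v v' ⁻¹' S) := by
  intro x u s r hs hr hsr t
  simp only [mem_preimage, horFrame_horLine] at hs hr ⊢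
  exact hS _ _ s r hs hr hsr t

lemma HorConvex.preimage_horFrame {A : Set Heis} (hA : HorConvex A) (p : Heis) (v v' : ℝ × ℝ) :
    HorConvex (horFrame p v v' ⁻¹' A) := by
  intro x hx y hy hxy t h0 h1
  rw [mem_preimage, horFrame_segment]
  exact hA _ hx _ hy (by rw [horForm_horFrame, hxy, mul_zero]) t h0 h1

lemma eq_univ_of_preimage_horFrame {S : Set Heis} {p : Heis} {v v' : ℝ × ℝ}
    (h : v.1 * v'.2 - v.2 * v'.1 ≠ 0) (hS : horFrame p v v' ⁻¹' S = univ) : S = univ := by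
  refine eq_univ_of_forall fun q => ?_
  have : horFrameInv p v v' q ∈ horFrame p v v' ⁻¹' S := hS ▸ mem_univ _
  rwa [mem_preimage, horFrame_horFrameInv p h] at this

lemma eventually_add_mul_ne_zero (c : ℝ) {n : ℝ} (hn : n ≠ 0) :
    ∀ᶠ e : ℝ in 𝓝[≠] 0, c + e * n ≠ 0 := by
  rcases eq_or_ne c 0 with rfl | hc
  · filter_upwards [self_mem_nhdsWithin] with e he
    simpa using ⟨he, hn⟩
  · refine nhdsWithin_le_nhds (ContinuousAt.eventually_ne (by fun_prop) ?_)
    simpa using hc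

lemma LineClosed.mem_of_horizontal_plane_subset {S : Set Heis} (hS : LineClosed S)
    (h0 : ∀ x y : ℝ, ((x, y, 0) : Heis) ∈ S) {q m : Heis} (hq : q ∈ S) (hq0 : q.2.2 ≠ 0)
    (hqm : horForm q m = 0) (hw : q.2.2 ≠ m.2.2) : m ∈ S := by
  have hd : q.2.2 - m.2.2 ≠ 0 := sub_ne_zero.2 hw
  set t := q.2.2 / (q.2.2 - m.2.2) with ht
  have ht0 : t ≠ 0 := div_ne_zero hq0 hd
  have h1 : q + t • (m - q) ∈ S := by
    convert h0 (q.1 + t * (m.1 - q.1)) (q.2.1 + t * (m.2.1 - q.2.1)) using 1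
    refine Prod.ext ?_ (Prod.ext ?_ ?_) <;> simp [ht]
    field_simp
    ring
  have := hS.mem_of_segment hq h1 (by rw [horForm_segment, horForm_self, hqm]; ring) t⁻¹
  rwa [add_sub_cancel_left, smul_smul, inv_mul_cancel₀ ht0, one_smul, add_sub_cancel] at this

lemma LineClosed.eq_univ_of_horizontal_plane_subset {S : Set Heis} (hS : LineClosed S)
    (hc : IsClosed S) (h0 : ∀ x y : ℝ, ((x, y, 0) : Heis) ∈ S) {q : Heis} (hq : q ∈ S)
    (hq0 : q.2.2 ≠ 0) (hq1 : q.1 ^ 2 + q.2.1 ^ 2 ≠ 0) : S = univ := by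
  have generic : ∀ r : Heis, q.1 * r.2.1 - q.2.1 * r.1 ≠ 0 → r ∈ S := by
    intro r hr
    set W := |q.2.2| + |r.2.2| + 1 with hW
    have hWq : q.2.2 < W := by
      have := le_abs_self q.2.2; have := abs_nonneg r.2.2; linarith
    have hWr : r.2.2 < W := by
      have := le_abs_self r.2.2; have := abs_nonneg q.2.2; linarith
    have hW0 : W ≠ 0 := by positivity
    obtain ⟨d, hd⟩ : ∃ d, d = q.1 * r.2.1 - q.2.1 * r.1 := ⟨_, rfl⟩
    rw [← hd] at hr
    set m : Heis := ((r.1 * (W - q.2.2) - q.1 * (W - r.2.2)) / d,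
      (r.2.1 * (W - q.2.2) - q.2.1 * (W - r.2.2)) / d, W) with hm
    have hqm : horForm q m = 0 := by
      simp only [horForm, hm]; field_simp; rw [hd]; ring
    have hmr : horForm m r = 0 := by
      simp only [horForm, hm]; field_simp; rw [hd]; ring
    have hmS : m ∈ S := hS.mem_of_horizontal_plane_subset h0 hq hq0 hqm hWq.ne
    exact hS.mem_of_horizontal_plane_subset h0 hmS hW0 hmr hWr.ne'
  refine eq_univ_of_forall fun r => ?_
  have hlim : Tendsto (fun e : ℝ => ((r.1 - e * q.2.1, r.2.1 + e * q.1, r.2.2) : Heis))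
      (𝓝[≠] 0) (𝓝 r) := by
    refine Tendsto.mono_left (Continuous.tendsto' (by fun_prop) _ _ ?_) nhdsWithin_le_nhds
    simp
  refine hc.mem_of_tendsto hlim ?_
  filter_upwards [eventually_add_mul_ne_zero (q.1 * r.2.1 - q.2.1 * r.1) hq1] with e he
  refine generic _ ?_
  convert he using 1
  simp only; ring

lemma LineClosed.eq_univ_of_standard_skew {S : Set Heis} (hS : LineClosed S) (hc : IsClosed S)
    (h1 : ∀ s : ℝ, ((s, 0, 0) : Heis) ∈ S) (h2 : ∀ t : ℝ, ((0, t, 1) : Heis) ∈ S) :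
    S = univ := by
  have hT : ∀ s l : ℝ, s ≠ 0 → (((1 - l) * s, l / s, l) : Heis) ∈ S := by
    intro s l hs
    convert hS.mem_of_segment (h1 s) (h2 (1 / s)) (by simp [horForm, hs]) l using 1
    refine Prod.ext ?_ (Prod.ext ?_ ?_) <;> simp
    · ring
    · ring
  set g : Heis := (1 / 2, 1 / 2, 1 / 2) with hg
  have hgS : g ∈ S := by
    convert hT 1 (1 / 2) one_ne_zero using 1
    norm_num [hg]
  have generic : ∀ x y : ℝ, x + y ≠ 0 → 3 * y - x ≠ 0 → y - 3 * x ≠ 0 →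
      horFrame g (1, 0) (0, 1) (x, y, 0) ∈ S := by
    intro x y h3 h4 h5
    set m : ℝ := (x - 3 * y) / (2 * (x + y)) with hm
    have hm0 : m ≠ 0 := div_ne_zero (fun h => h4 (by linarith)) (by positivity)
    have hm' : 1 + m = (3 * x - y) / (2 * (x + y)) := by
      rw [hm]; field_simp; ring
    have hm1 : 1 + m ≠ 0 := by
      rw [hm']
      exact div_ne_zero (fun h => h5 (by linarith)) (by positivity)
    have hp : ((-1 - m, m, 1 + m) : Heis) ∈ S := by
      convert hT ((1 + m) / m) (1 + m) (div_ne_zero hm1 hm0) using 1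
      refine Prod.ext ?_ (Prod.ext ?_ ?_) <;> simp only <;> field_simp
      ring
    convert hS.mem_of_segment hgS hp (by simp only [horForm, hg]; ring) (-(x + y) / 2) using 1
    refine Prod.ext ?_ (Prod.ext ?_ ?_) <;> simp [horFrame, hg, hm] <;> field_simp <;> ring
  have hplane : ∀ x y : ℝ, horFrame g (1, 0) (0, 1) (x, y, 0) ∈ S := by
    intro x y
    have hlim : Tendsto (fun e : ℝ => horFrame g (1, 0) (0, 1) (x + e, y + e, 0))
        (𝓝[≠] 0) (𝓝 (horFrame g (1, 0) (0, 1) (x, y, 0))) := by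
      refine Tendsto.mono_left (Continuous.tendsto' ?_ _ _ (by simp)) nhdsWithin_le_nhds
      exact (continuous_horFrame _ _ _).comp (by fun_prop)
    refine hc.mem_of_tendsto hlim ?_
    filter_upwards [eventually_add_mul_ne_zero (x + y) (two_ne_zero),
      eventually_add_mul_ne_zero (3 * y - x) (two_ne_zero),
      eventually_add_mul_ne_zero (y - 3 * x) (neg_ne_zero.2 two_ne_zero)] with e he1 he2 he3
    refine generic _ _ ?_ ?_ ?_
    · convert he1 using 1; ring
    · convert he2 using 1; ring
    · convert he3 using 1; ring
  refine eq_univ_of_preimage_horFrame (p := g) (v := (1, 0)) (v' := (0, 1)) (by simp) ?_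
  refine (hS.preimage_horFrame g (1, 0) (0, 1)).eq_univ_of_horizontal_plane_subset
    (hc.preimage (continuous_horFrame _ _ _)) hplane (q := (-1 / 2, -1 / 2, -1 / 2)) ?_
    (by norm_num) (by norm_num)
  rw [mem_preimage]
  convert h1 0 using 1
  norm_num [horFrame, hg]

/-- The determinant of two planar directions. -/
def planarDet (v v' : ℝ × ℝ) : ℝ := v.1 * v'.2 - v.2 * v'.1

lemma LineClosed.eq_univ_of_skew {S : Set Heis} (hS : LineClosed S) (hc : IsClosed S)
    {p : Heis} {v v' : ℝ × ℝ} {h : ℝ} (hh : h ≠ 0) (hv : planarDet v v' ≠ 0)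
    (h1 : ∀ t, horLine p v t ∈ S) (h2 : ∀ t, horLine (p.1, p.2.1, p.2.2 + h) v' t ∈ S) :
    S = univ := by
  have hd : v.1 * (h / planarDet v v' * v'.2) - v.2 * (h / planarDet v v' * v'.1) = h := by
    have : v.1 * (h / planarDet v v' * v'.2) - v.2 * (h / planarDet v v' * v'.1) =
      h / planarDet v v' * planarDet v v' := by simp only [planarDet]; ring
    rw [this, div_mul_cancel₀ _ hv]
  refine eq_univ_of_preimage_horFrame (p := p) (v := v)
    (v' := (h / planarDet v v' * v'.1, h / planarDet v v' * v'.2)) (by rwa [hd]) ?_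
  refine (hS.preimage_horFrame _ _ _).eq_univ_of_standard_skew
    (hc.preimage (continuous_horFrame _ _ _)) (fun s => ?_) (fun t => ?_)
  · rw [mem_preimage]
    convert h1 s using 1
    simp [horFrame, horLine]
  · rw [mem_preimage]
    convert h2 (t * (h / planarDet v v')) using 1
    simp only [horFrame, hd, horLine]
    refine Prod.ext ?_ (Prod.ext ?_ ?_) <;> simp only <;> ring

lemma LineClosed.eq_univ_of_parallel {S : Set Heis} (hS : LineClosed S) (hc : IsClosed S)
    {p q : Heis} {v : ℝ × ℝ} (hv : planarDet v (q.1 - p.1, q.2.1 - p.2.1) ≠ 0)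
    (h1 : ∀ t, horLine p v t ∈ S) (h2 : ∀ t, horLine q v t ∈ S) : S = univ := by
  set d := planarDet v (q.1 - p.1, q.2.1 - p.2.1) with hd
  set q' := horLine q v (horForm p q / d) with hq'
  set e : ℝ × ℝ := (q'.1 - p.1, q'.2.1 - p.2.1) with he
  have hpq : horForm p q' = 0 := by
    have : horForm p q' = horForm p q - horForm p q / d * d := by
      simp only [hq', hd, horForm, horLine, planarDet]; ring
    rw [this, div_mul_cancel₀ _ hv, sub_self]
  have hde : v.1 * e.2 - v.2 * e.1 = d := by
    simp only [hd, he, hq', horLine, planarDet]; ring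
  have h2' : ∀ t, horLine q' v t ∈ S := by
    intro t
    convert h2 (horForm p q / d + t) using 1
    simp only [hq', horLine]
    refine Prod.ext ?_ (Prod.ext ?_ ?_) <;> simp only <;> ring
  refine eq_univ_of_preimage_horFrame (p := p) (v := v) (v' := e) (by rwa [hde]) ?_
  have hS' := hS.preimage_horFrame p v e
  have hc' := hc.preimage (continuous_horFrame p v e)
  have k1 : ∀ s : ℝ, ((s, 0, 0) : Heis) ∈ horFrame p v e ⁻¹' S := by
    intro s
    rw [mem_preimage]
    convert h1 s using 1
    simp [horFrame, horLine]
  have k2 : ∀ s : ℝ, ((s, 1, -s) : Heis) ∈ horFrame p v e ⁻¹' S := by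
    intro s
    rw [mem_preimage]
    convert h2' s using 1
    simp only [horForm] at hpq
    refine Prod.ext ?_ (Prod.ext ?_ ?_) <;> simp only [horFrame, horLine, he]
    · ring
    · ring
    · linear_combination -hpq
  have k3 : ∀ s l : ℝ, ((s * (1 - 2 * l), l, l * s) : Heis) ∈ horFrame p v e ⁻¹' S := by
    intro s l
    convert hS'.mem_of_segment (k1 s) (k2 (-s)) (by simp [horForm]) l using 1
    refine Prod.ext ?_ (Prod.ext ?_ ?_) <;> simp
    ring
  refine hS'.eq_univ_of_skew hc' (p := (0, 1 / 2, 0)) (v := (0, 1)) (v' := (-2, 1))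
    (h := 1 / 2) (by norm_num) (by simp [planarDet]) (fun t => ?_) (fun t => ?_)
  · convert k3 0 (1 / 2 + t) using 1
    simp [horLine]
  · convert k3 1 (1 / 2 + t) using 1
    simp only [horLine]
    refine Prod.ext ?_ (Prod.ext ?_ ?_) <;> simp only <;> ring

lemma HorConvex.ray_subset {A : Set Heis} (hB : HorConvex Aᶜ) {p : Heis} (hp : p ∈ A)
    (v : ℝ × ℝ) :
    (∀ t, 0 ≤ t → horLine p v t ∈ A) ∨ ∀ t, 0 ≤ t → horLine p (-v) t ∈ A := by
  by_contra! h
  obtain ⟨⟨t, ht, htA⟩, s, hs, hsA⟩ := h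
  rw [horLine_neg] at hsA
  have ht' : 0 < t := by
    refine ht.lt_of_ne ?_
    rintro rfl
    rw [horLine_zero] at htA
    exact htA hp
  have := hB _ htA _ hsA (horForm_horLine _ _ _ _) (t / (t + s)) (by positivity)
    (by rw [div_le_one (by positivity)]; linarith)
  rw [horLine_segment] at this
  have e : t + t / (t + s) * (-s - t) = 0 := by field_simp; ring
  rw [e, horLine_zero] at this
  exact this hp

lemma eventually_exists_zero {Z : Type*} [TopologicalSpace Z] {f : Z × ℝ → ℝ} (hf : Continuous f)
    {z : Z} {c d : ℝ} {O : Set (Z × ℝ)} (hO : O ∈ 𝓝 (z, c)) (h0 : f (z, c) = 0)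
    (hd : HasDerivAt (fun k => f (z, k)) d c) (hd0 : d ≠ 0) :
    ∀ᶠ w in 𝓝 z, ∃ k, f (w, k) = 0 ∧ (w, k) ∈ O := by
  wlog hpos : 0 < d generalizing f d
  · have := this (f := fun x => -f x) (d := -d) hf.neg (by simp [h0]) hd.neg (by simpa using hd0)
      (by have := lt_of_le_of_ne (not_lt.1 hpos) hd0; linarith)
    simpa using this
  obtain ⟨U, hU, W, hW, hUW⟩ := mem_nhds_prod_iff.1 hO
  have hsign := eventually_nhdsWithin_sign_eq_of_deriv_pos (by rw [hd.deriv]; exact hpos) h0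
  obtain ⟨e, he, hball⟩ := Metric.mem_nhds_iff.1 (Filter.inter_mem hW hsign)
  have hmem : ∀ k, |k - c| < e → k ∈ W ∧ SignType.sign (f (z, k)) = SignType.sign (k - c) :=
    fun k hk => hball (by rwa [Metric.mem_ball, Real.dist_eq])
  have hp : 0 < f (z, c + e / 2) := by
    have := (hmem (c + e / 2) (by rw [add_sub_cancel_left, abs_of_pos] <;> linarith)).2
    rwa [add_sub_cancel_left, sign_pos (a := e / 2) (by linarith), sign_eq_one_iff] at this
  have hn : f (z, c - e / 2) < 0 := by
    have := (hmem (c - e / 2) (by rw [sub_sub_cancel_left, abs_neg, abs_of_pos] <;> linarith)).2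
    rwa [sub_sub_cancel_left, sign_neg (a := -(e / 2)) (by linarith), sign_eq_neg_one_iff] at this
  have ep : ∀ᶠ w in 𝓝 z, 0 < f (w, c + e / 2) :=
    Continuous.tendsto (by fun_prop) z |>.eventually_const_lt hp
  have en : ∀ᶠ w in 𝓝 z, f (w, c - e / 2) < 0 :=
    Continuous.tendsto (by fun_prop) z |>.eventually_lt_const hn
  filter_upwards [ep, en, hU] with w hwp hwn hwU
  obtain ⟨k, hk, hk0⟩ := intermediate_value_Icc (by linarith : c - e / 2 ≤ c + e / 2)
    (by fun_prop : ContinuousOn (fun k => f (w, k)) _) ⟨hwn.le, hwp.le⟩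
  refine ⟨k, hk0, hUW (mk_mem_prod hwU (hmem k ?_).1)⟩
  rw [abs_lt]
  constructor <;> linarith [hk.1, hk.2]

/-- A horizontally convex set containing a ray on the first axis and arcs of the lines
`(1, y, y)` and `(x, 1, -x)` that are joined by horizontal lines has nonempty interior. -/
lemma HorConvex.interior_nonempty_of_arcs {A : Set Heis} (hA : HorConvex A)
    (h0 : ∀ x : ℝ, 0 ≤ x → ((x, 0, 0) : Heis) ∈ A) {k a b c : ℝ} (hk : k ≠ 0)
    (h1 : ∀ᶠ j in 𝓝 k, ((1, 1 + 2 / j, 1 + 2 / j) : Heis) ∈ A)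
    (h2 : ∀ᶠ j in 𝓝 k, ((1 + j, 1, -(1 + j)) : Heis) ∈ A)
    (ha : a = 1 + k / 4) (hb : b = 1 + 3 / (2 * k)) (hb0 : b ≠ 0) (hc0 : 0 < c)
    (hc : c * b = 1 / 2 + 3 / (2 * k) - k / 4)
    (hd : (a - c) * (b - 1) + (a - 1) * b - (b - c * b - a + c) / 2 ≠ 0) :
    (interior A).Nonempty := by
  set L : Heis × ℝ → ℝ := fun x =>
    (x.2 * x.1.2.1 - x.2 * x.1.2.2 * x.1.2.1 - (x.1.2.2 + x.2 * (x.1.1 - x.1.2.2)) + 1) / 2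
    with hL
  set M : Heis × ℝ → ℝ := fun x => x.1.2.2 + x.2 * (x.1.1 - x.1.2.2) - 1 with hM
  set f : Heis × ℝ → ℝ := fun x => M x * (x.2 * x.1.2.1 - 1) - 2 * L x * (1 - L x) with hf
  have cL : Continuous L := by fun_prop
  have cM : Continuous M := by fun_prop
  have cf : Continuous f := by fun_prop
  set z : Heis := ((c + a) / 2, b / 2, c) with hz
  have Lz : L (z, 2) = 1 / 4 := by
    simp only [hL, hz]
    linear_combination (-1 / 2) * hc + (1 / 2) * hb - (1 / 2) * ha
  have Mz : M (z, 2) = k / 4 := by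
    simp only [hM, hz]
    linear_combination ha
  have fz : f (z, 2) = 0 := by
    simp only [hf, Lz, Mz]
    simp only [hz, hb]
    field_simp
    ring
  have der : HasDerivAt (fun j => f (z, j))
      (((a - c) * (b - 1) + (a - 1) * b - (b - c * b - a + c) / 2) / 2) 2 := by
    have dM : HasDerivAt (fun j => M (z, j)) ((a - c) / 2) 2 := by
      simp only [hM, hz]
      exact ((((hasDerivAt_id (2 : ℝ)).mul_const ((c + a) / 2 - c)).const_add c).sub_const
        1).congr_deriv (by ring)
    have dL : HasDerivAt (fun j => L (z, j)) ((b - c * b - a + c) / 4) 2 := by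
      have : (fun j : ℝ => L (z, j)) =
          fun j => j * ((b - c * b - a + c) / 4) + (1 - c) / 2 := by
        funext j
        simp only [hL, hz]; ring
      rw [this]
      exact (((hasDerivAt_id (2 : ℝ)).mul_const ((b - c * b - a + c) / 4)).add_const
        _).congr_deriv (by ring)
    have dY : HasDerivAt (fun j : ℝ => j * (b / 2) - 1) (b / 2) 2 := by
      exact (((hasDerivAt_id (2 : ℝ)).mul_const (b / 2)).sub_const 1).congr_deriv (by ring)
    have := (dM.mul dY).sub ((dL.const_mul 2).mul (dL.const_sub 1))
    simp only [Lz, Mz] at this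
    exact this.congr_deriv (by linear_combination (-b / 2) * ha)
  have c1 : ContinuousAt (fun x => M x / L x) (z, 2) :=
    cM.continuousAt.div cL.continuousAt (by rw [Lz]; norm_num)
  have hk' : M (z, 2) / L (z, 2) = k := by rw [Lz, Mz]; ring
  have c2 : ContinuousAt (fun x : Heis × ℝ => x.1.2.2) (z, 2) := by fun_prop
  have c3 : ContinuousAt (fun x : Heis × ℝ => x.2) (z, 2) := by fun_prop
  have hO : ∀ᶠ x in 𝓝 (z, (2 : ℝ)), (((1, 1 + 2 / (M x / L x), 1 + 2 / (M x / L x)) : Heis) ∈ A ∧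
      ((1 + M x / L x, 1, -(1 + M x / L x)) : Heis) ∈ A) ∧
      (0 < L x ∧ L x < 1 ∧ M x ≠ 0) ∧ 0 < x.1.2.2 ∧ 1 < x.2 := by
    have e1 := c1.tendsto.eventually (hk'.symm ▸ h1.and h2)
    have e2 : ∀ᶠ x in 𝓝 (z, (2 : ℝ)), 0 < L x :=
      cL.continuousAt.tendsto.eventually_const_lt (by rw [Lz]; norm_num)
    have e3 : ∀ᶠ x in 𝓝 (z, (2 : ℝ)), L x < 1 :=
      cL.continuousAt.tendsto.eventually_lt_const (by rw [Lz]; norm_num)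
    have e4 : ∀ᶠ x in 𝓝 (z, (2 : ℝ)), M x ≠ 0 :=
      cM.continuousAt.eventually_ne (by rw [Mz]; exact div_ne_zero hk (by norm_num))
    have e5 : ∀ᶠ x : Heis × ℝ in 𝓝 (z, (2 : ℝ)), 0 < x.1.2.2 := c2.tendsto.eventually_const_lt hc0
    have e6 : ∀ᶠ x : Heis × ℝ in 𝓝 (z, (2 : ℝ)), 1 < x.2 :=
      c3.tendsto.eventually_const_lt (by norm_num)
    exact e1.and ((e2.and (e3.and e4)).and (e5.and e6))
  have main := eventually_exists_zero cf hO fz der (div_ne_zero hd two_ne_zero)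
  have main' : ∀ᶠ w in 𝓝 z, ((w.1, w.2.1, w.2.2 * w.2.1) : Heis) ∈ A := by
    filter_upwards [main] with w hw
    obtain ⟨j, hj0, ⟨hP, hQ⟩, ⟨hl0, hl1, hm0⟩, hw0, hj1⟩ := hw
    set l := L (w, j) with hl
    set m := M (w, j) with hm
    have hj0 : m * (j * w.2.1 - 1) - 2 * l * (1 - l) = 0 := hj0
    have hN := hA _ hP _ hQ (by simp only [horForm]; field_simp; ring) l hl0.le hl1.le
    have hy : j * w.2.1 = 1 + 2 * l * (1 - l) / m := by
      field_simp; linear_combination hj0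
    have hN' : ((1 + m, j * w.2.1, j * w.2.2 * w.2.1) : Heis) ∈ A := by
      convert hN using 1
      refine Prod.ext ?_ (Prod.ext ?_ ?_) <;> simp
      · field_simp
      · rw [hy]; field_simp; ring
      · have : j * w.2.2 * w.2.1 = j * w.2.1 - m - 2 * l := by
          simp only [hl, hm, hL, hM]; ring
        rw [this, hy]; field_simp; ring
    have := hA _ (h0 w.2.2 hw0.le) _ hN' (by simp only [horForm]; ring) j⁻¹ (by positivity)
      (inv_le_one_of_one_le₀ hj1.le)
    have hj : j ≠ 0 := by positivity
    convert this using 1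
    refine Prod.ext ?_ (Prod.ext ?_ ?_) <;> simp
    · simp only [hm, hM]; field_simp; ring
    · field_simp
    · field_simp
  refine ⟨((c + a) / 2, b / 2, c * (b / 2)), mem_interior_iff_mem_nhds.2 ?_⟩
  have hb2 : b / 2 ≠ 0 := div_ne_zero hb0 two_ne_zero
  have ct : ContinuousAt (fun x : Heis => ((x.1, x.2.1, x.2.2 / x.2.1) : Heis))
      ((c + a) / 2, b / 2, c * (b / 2)) := by
    fun_prop (disch := exact hb2)
  have e1 := ct.tendsto.eventually (p := fun w => ((w.1, w.2.1, w.2.2 * w.2.1) : Heis) ∈ A)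
    (by simpa only [mul_div_cancel_right₀ _ hb2] using main')
  have ct2 : ContinuousAt (fun x : Heis => x.2.1) ((c + a) / 2, b / 2, c * (b / 2)) := by fun_prop
  filter_upwards [e1, ct2.eventually_ne hb2] with x hx hx0
  simpa only [div_mul_cancel₀ _ hx0] using hx

lemma HorConvex.interior_nonempty_of_axes {A : Set Heis} (hA : HorConvex A) (hB : HorConvex Aᶜ)
    (h1 : ∀ x : ℝ, 0 ≤ x → ((x, 0, 0) : Heis) ∈ A)
    (h2 : ∀ y : ℝ, 0 ≤ y → ((0, y, 0) : Heis) ∈ A) : (interior A).Nonempty := by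
  have hP : (∀ t : ℝ, 0 ≤ t → ((1, t, t) : Heis) ∈ A) ∨
      ∀ t : ℝ, t ≤ 0 → ((1, t, t) : Heis) ∈ A := by
    refine (hB.ray_subset (h1 1 zero_le_one) (0, 1)).imp (fun h t ht => ?_) fun h t ht => ?_
    · simpa [horLine] using h t ht
    · simpa [horLine] using h (-t) (by linarith)
  have hQ : (∀ t : ℝ, 0 ≤ t → ((t, 1, -t) : Heis) ∈ A) ∨
      ∀ t : ℝ, t ≤ 0 → ((t, 1, -t) : Heis) ∈ A := by
    refine (hB.ray_subset (h2 1 zero_le_one) (1, 0)).imp (fun h t ht => ?_) fun h t ht => ?_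
    · simpa [horLine] using h t ht
    · simpa [horLine] using h (-t) (by linarith)
  have cP : ∀ k : ℝ, k ≠ 0 → ContinuousAt (fun j : ℝ => 1 + 2 / j) k := by
    intro k hk
    fun_prop (disch := exact hk)
  have cQ : ∀ k : ℝ, ContinuousAt (fun j : ℝ => 1 + j) k := by
    intro k
    fun_prop
  rcases hP with hP | hP <;> rcases hQ with hQ | hQ
  · refine hA.interior_nonempty_of_arcs h1 (k := 1) (a := 5 / 4) (b := 5 / 2) (c := 7 / 10)
      (by norm_num) ?_ ?_ (by norm_num) (by norm_num) (by norm_num) (by norm_num) (by norm_num)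
      (by norm_num)
    · filter_upwards [(cP 1 (by norm_num)).tendsto.eventually_const_lt (u := 0) (by norm_num)]
        with j hj using hP _ hj.le
    · filter_upwards [(cQ 1).tendsto.eventually_const_lt (u := 0) (by norm_num)] with j hj
        using hQ _ hj.le
  · refine hA.interior_nonempty_of_arcs h1 (k := -4) (a := 0) (b := 5 / 8) (c := 9 / 5)
      (by norm_num) ?_ ?_ (by norm_num) (by norm_num) (by norm_num) (by norm_num) (by norm_num)
      (by norm_num)
    · filter_upwards [(cP (-4) (by norm_num)).tendsto.eventually_const_lt (u := 0) (by norm_num)]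
        with j hj using hP _ hj.le
    · filter_upwards [(cQ (-4)).tendsto.eventually_lt_const (u := 0) (by norm_num)] with j hj
        using hQ _ hj.le
  · refine hA.interior_nonempty_of_arcs h1 (k := -1 / 2) (a := 7 / 8) (b := -2) (c := 19 / 16)
      (by norm_num) ?_ ?_ (by norm_num) (by norm_num) (by norm_num) (by norm_num) (by norm_num)
      (by norm_num)
    · filter_upwards [(cP (-1 / 2) (by norm_num)).tendsto.eventually_lt_const (u := 0)
        (by norm_num)]
        with j hj using hP _ hj.le
    · filter_upwards [(cQ (-1 / 2)).tendsto.eventually_const_lt (u := 0) (by norm_num)] with j hj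
        using hQ _ hj.le
  · refine hA.interior_nonempty_of_arcs h1 (k := -4 / 3) (a := 2 / 3) (b := -1 / 8) (c := 7 / 3)
      (by norm_num) ?_ ?_ (by norm_num) (by norm_num) (by norm_num) (by norm_num) (by norm_num)
      (by norm_num)
    · filter_upwards [(cP (-4 / 3) (by norm_num)).tendsto.eventually_lt_const (u := 0)
        (by norm_num)]
        with j hj using hP _ hj.le
    · filter_upwards [(cQ (-4 / 3)).tendsto.eventually_lt_const (u := 0) (by norm_num)] with j hj
        using hQ _ hj.le

lemma horFrameInv_horFrame (p : Heis) {v v' : ℝ × ℝ} (h : v.1 * v'.2 - v.2 * v'.1 ≠ 0)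
    (q : Heis) : horFrameInv p v v' (horFrame p v v' q) = q := by
  have e1 : (horFrameInv p v v' (horFrame p v v' q)).1 = q.1 := by
    simp only [horFrame, horFrameInv]
    rw [div_eq_iff h]; ring
  have e2 : (horFrameInv p v v' (horFrame p v v' q)).2.1 = q.2.1 := by
    simp only [horFrame, horFrameInv]
    rw [div_eq_iff h]; ring
  refine Prod.ext e1 (Prod.ext e2 ?_)
  simp only [horFrameInv] at e1 e2 ⊢
  rw [e1, e2, div_eq_iff h]
  simp only [horFrame]
  ring

lemma HorConvex.interior_nonempty {A : Set Heis} (hA : HorConvex A) (hB : HorConvex Aᶜ)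
    (hne : A.Nonempty) : (interior A).Nonempty := by
  obtain ⟨g, hg⟩ := hne
  have key : ∀ v v' : ℝ × ℝ, v.1 * v'.2 - v.2 * v'.1 ≠ 0 →
      (∀ t, 0 ≤ t → horLine g v t ∈ A) → (∀ t, 0 ≤ t → horLine g v' t ∈ A) →
      (interior A).Nonempty := by
    intro v v' hd hv hv'
    have hpre := (hA.preimage_horFrame g v v').interior_nonempty_of_axes
      (hB.preimage_horFrame g v v')
      (fun x hx => by
        rw [mem_preimage]
        convert hv x hx using 1
        simp [horFrame, horLine])
      (fun y hy => by
        rw [mem_preimage]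
        convert hv' y hy using 1
        simp [horFrame, horLine])
    obtain ⟨x, hx⟩ := hpre
    refine ⟨horFrame g v v' x, mem_interior.2 ⟨horFrameInv g v v' ⁻¹'
      interior (horFrame g v v' ⁻¹' A), fun q hq => ?_,
      isOpen_interior.preimage (continuous_horFrameInv g v v'), ?_⟩⟩
    · have := interior_subset hq
      rwa [mem_preimage, horFrame_horFrameInv g hd] at this
    · rwa [mem_preimage, horFrameInv_horFrame g hd]
  rcases hB.ray_subset hg (1, 0) with h | h <;> rcases hB.ray_subset hg (0, 1) with h' | h' <;>
    exact key _ _ (by simp) h h'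

lemma horLine_horLine (p : Heis) (v : ℝ × ℝ) (s t : ℝ) :
    horLine (horLine p v s) v t = horLine p v (s + t) := by
  simp only [horLine]
  refine Prod.ext ?_ (Prod.ext ?_ ?_) <;> simp only <;> ring

lemma exists_smul_of_planarDet_eq_zero {d v : ℝ × ℝ} (hd : d ≠ 0) (h : planarDet d v = 0) :
    ∃ c : ℝ, v = c • d := by
  simp only [planarDet] at h
  by_cases h1 : d.1 = 0
  · have h2 : d.2 ≠ 0 := fun h2 => hd (Prod.ext h1 h2)
    refine ⟨v.2 / d.2, Prod.ext ?_ ?_⟩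
    · simp only [h1, zero_mul, zero_sub, neg_eq_zero, mul_eq_zero, h2, false_or] at h
      simp [h1, h]
    · simp [div_mul_cancel₀ _ h2]
  · refine ⟨v.1 / d.1, Prod.ext ?_ ?_⟩
    · simp [div_mul_cancel₀ _ h1]
    · simp only [Prod.smul_snd, smul_eq_mul]
      field_simp
      linarith

lemma horLine_mem_of_planarDet_eq_zero {S : Set Heis} {p : Heis} {d v : ℝ × ℝ} (hd : d ≠ 0)
    (h : planarDet d v = 0) (h1 : ∀ t, horLine p d t ∈ S) (t : ℝ) : horLine p v t ∈ S := by
  obtain ⟨c, rfl⟩ := exists_smul_of_planarDet_eq_zero hd h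
  convert h1 (t * c) using 1
  simp only [horLine, Prod.smul_fst, Prod.smul_snd, smul_eq_mul]
  refine Prod.ext ?_ (Prod.ext ?_ ?_) <;> simp only <;> ring

lemma LineClosed.exists_horLine_eq {S : Set Heis} (hS : LineClosed S) (hc : IsClosed S)
    (hne : S ≠ univ) {p q : Heis} {v v' : ℝ × ℝ} (hv : planarDet v v' ≠ 0)
    (h1 : ∀ t, horLine p v t ∈ S) (h2 : ∀ t, horLine q v' t ∈ S) :
    ∃ s t, horLine p v s = horLine q v' t := by
  set e : ℝ × ℝ := (q.1 - p.1, q.2.1 - p.2.1) with he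
  refine ⟨planarDet e v' / planarDet v v', planarDet e v / planarDet v v', ?_⟩
  set P := horLine p v (planarDet e v' / planarDet v v') with hP
  set Q := horLine q v' (planarDet e v / planarDet v v') with hQ
  have e1 : P.1 = Q.1 := by
    simp only [hP, hQ, horLine]
    field_simp
    simp only [he, planarDet]; ring
  have e2 : P.2.1 = Q.2.1 := by
    simp only [hP, hQ, horLine]
    field_simp
    simp only [he, planarDet]; ring
  refine Prod.ext e1 (Prod.ext e2 ?_)
  by_contra h3
  refine hne (hS.eq_univ_of_skew hc (p := P) (h := Q.2.2 - P.2.2)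
    (sub_ne_zero.2 (Ne.symm h3)) hv (fun t => ?_) fun t => ?_)
  · rw [hP, horLine_horLine]; exact h1 _
  · have : ((P.1, P.2.1, P.2.2 + (Q.2.2 - P.2.2)) : Heis) = Q := by
      rw [e1, e2, add_sub_cancel]
    rw [this, hQ, horLine_horLine]; exact h2 _

lemma LineClosed.horForm_eq_zero_of_planarDet_ne_zero {S : Set Heis} (hS : LineClosed S)
    (hc : IsClosed S) (hne : S ≠ univ) {g s : Heis} {v v' d : ℝ × ℝ} (hv : planarDet v v' ≠ 0)
    (h1 : ∀ t, horLine g v t ∈ S) (h2 : ∀ t, horLine g v' t ∈ S) (hd0 : d ≠ 0)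
    (hd : ∀ t, horLine s d t ∈ S) (hdv : planarDet v d ≠ 0) : horForm g s = 0 := by
  have key : ∀ t, g = horLine s d t → horForm g s = 0 := by
    intro t ht
    have := horForm_horLine s d t 0
    rwa [← ht, horLine_zero] at this
  obtain ⟨t, r, htr⟩ := hS.exists_horLine_eq hc hne hdv h1 hd
  by_cases hdv' : planarDet d v' = 0
  · have hz : planarDet v' (s.1 - g.1, s.2.1 - g.2.1) = 0 := by
      by_contra hz
      exact hne (hS.eq_univ_of_parallel hc hz h2 (horLine_mem_of_planarDet_eq_zero hd0 hdv' hd))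
    have e1 : g.1 + t * v.1 = s.1 + r * d.1 := congrArg (fun x : Heis => x.1) htr
    have e2 : g.2.1 + t * v.2 = s.2.1 + r * d.2 := congrArg (fun x : Heis => x.2.1) htr
    have : t * planarDet v v' = 0 := by
      simp only [planarDet] at hdv' hz ⊢
      linear_combination r * hdv' - hz + v'.2 * e1 - v'.1 * e2
    obtain rfl := (mul_eq_zero.1 this).resolve_right hv
    rw [horLine_zero] at htr
    exact key r htr
  · have hdv2 : planarDet v' d ≠ 0 := by
      contrapose! hdv'
      simp only [planarDet] at hdv' ⊢
      linarith
    obtain ⟨t', r', htr'⟩ := hS.exists_horLine_eq hc hne hdv2 h2 hd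
    have h0 : horForm (horLine g v t) (horLine g v' t') = 0 := by
      rw [htr, htr']; exact horForm_horLine _ _ _ _
    have : t * t' * planarDet v v' = 0 := by
      simp only [horForm, horLine] at h0
      simp only [planarDet]
      linear_combination -h0
    rcases mul_eq_zero.1 ((mul_eq_zero.1 this).resolve_right hv) with rfl | rfl
    · rw [horLine_zero] at htr
      exact key r htr
    · rw [horLine_zero] at htr'
      exact key r' htr'

lemma LineClosed.horForm_eq_zero {S : Set Heis} (hS : LineClosed S)
    (hc : IsClosed S) (hne : S ≠ univ) {g s : Heis} {v v' d : ℝ × ℝ} (hv : planarDet v v' ≠ 0)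
    (h1 : ∀ t, horLine g v t ∈ S) (h2 : ∀ t, horLine g v' t ∈ S) (hd0 : d ≠ 0)
    (hd : ∀ t, horLine s d t ∈ S) : horForm g s = 0 := by
  by_cases hdv : planarDet v d = 0
  · refine hS.horForm_eq_zero_of_planarDet_ne_zero hc hne (v := v') (v' := v) ?_ h2 h1 hd0 hd ?_
    · contrapose! hv
      simp only [planarDet] at hv ⊢
      linarith
    · intro hdv'
      obtain ⟨c, rfl⟩ := exists_smul_of_planarDet_eq_zero (v := v) hd0
        (by simp only [planarDet] at hdv ⊢; linarith)
      obtain ⟨c', rfl⟩ := exists_smul_of_planarDet_eq_zero (v := v') hd0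
        (by simp only [planarDet] at hdv' ⊢; linarith)
      apply hv
      simp only [planarDet, Prod.smul_fst, Prod.smul_snd, smul_eq_mul]
      ring
  · exact hS.horForm_eq_zero_of_planarDet_ne_zero hc hne hv h1 h2 hd0 hd hdv

/-- A proper closed set that is ruled by horizontal lines and closed under taking horizontal lines
is contained in a horizontal or a vertical plane. -/
lemma LineClosed.subset_plane {S : Set Heis} (hS : LineClosed S) (hc : IsClosed S)
    (hne : S ≠ univ) (hl : ∀ s ∈ S, ∃ d : ℝ × ℝ, d ≠ 0 ∧ ∀ t, horLine s d t ∈ S) {p : Heis}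
    (hp : p ∈ S) :
    (∃ g ∈ S, ∀ s ∈ S, horForm g s = 0) ∨
      ∃ d : ℝ × ℝ, d ≠ 0 ∧ ∀ s ∈ S, planarDet d (s.1 - p.1, s.2.1 - p.2.1) = 0 := by
  obtain ⟨d, hd0, hd⟩ := hl p hp
  by_cases h : ∃ s ∈ S, ∃ e : ℝ × ℝ, (∀ t, horLine s e t ∈ S) ∧ planarDet d e ≠ 0
  · left
    obtain ⟨s, hs, e, he, hde⟩ := h
    obtain ⟨t, r, htr⟩ := hS.exists_horLine_eq hc hne hde hd he
    refine ⟨horLine p d t, hd t, fun q hq => ?_⟩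
    obtain ⟨f, hf0, hf⟩ := hl q hq
    refine hS.horForm_eq_zero hc hne hde (fun u => ?_) (fun u => ?_) hf0 hf
    · rw [horLine_horLine]; exact hd _
    · rw [htr, horLine_horLine]; exact he _
  · right
    push Not at h
    refine ⟨d, hd0, fun s hs => ?_⟩
    obtain ⟨e, he0, he⟩ := hl s hs
    have hde := h s hs e he
    by_contra hz
    refine hne (hS.eq_univ_of_parallel hc hz hd (horLine_mem_of_planarDet_eq_zero he0 ?_ he))
    simp only [planarDet] at hde ⊢
    linarith

/-- Affine along segments. -/
def SegmentAffine (F : Heis → ℝ) : Prop :=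
  ∀ p q : Heis, ∀ t : ℝ, F (p + t • (q - p)) = (1 - t) * F p + t * F q

lemma SegmentAffine.neg {F : Heis → ℝ} (hF : SegmentAffine F) :
    SegmentAffine fun x => -F x := by
  intro p q t
  simp only [hF p q t]
  ring

lemma SegmentAffine.isPreconnected_pos {F : Heis → ℝ} (hF : SegmentAffine F) :
    IsPreconnected {x | 0 < F x} := by
  refine Convex.isPreconnected (convex_iff_segment_subset.2 fun p hp q hq => ?_)
  rw [segment_eq_image']
  rintro _ ⟨t, ⟨ht0, ht1⟩, rfl⟩
  simp only [mem_ofPred_eq] at hp hq ⊢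
  rw [hF p q t]
  rcases ht0.eq_or_lt with rfl | ht0
  · simpa using hp
  · have := mul_nonneg (sub_nonneg.2 ht1) hp.le
    have := mul_pos ht0 hq
    linarith

lemma SegmentAffine.mem_closure_pos {F : Heis → ℝ} (hF : SegmentAffine F) {y : Heis}
    (hy : 0 < F y) {z : Heis} (hz : 0 ≤ F z) : z ∈ closure {x | 0 < F x} := by
  have ht : Tendsto (fun t : ℝ => z + t • (y - z)) (𝓝[>] 0) (𝓝 z) := by
    have : Continuous fun t : ℝ => z + t • (y - z) := by fun_prop
    have h0 := this.tendsto 0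
    rw [zero_smul, add_zero] at h0
    exact h0.mono_left nhdsWithin_le_nhds
  refine mem_closure_of_tendsto ht ?_
  filter_upwards [Ioc_mem_nhdsGT zero_lt_one] with t ht
  rw [hF z y t]
  have := mul_nonneg (sub_nonneg.2 ht.2) hz
  have := mul_pos ht.1 hy
  linarith

lemma SegmentAffine.exists_sides {F : Heis → ℝ} (hF : SegmentAffine F)
    (hne : ∃ x, F x ≠ 0) {A : Set Heis} (hfr : (frontier A).Nonempty)
    (hsub : ∀ x ∈ frontier A, F x = 0) (hA : (interior A).Nonempty)
    (hB : (interior Aᶜ).Nonempty) :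
    ∃ G : Heis → ℝ, (G = F ∨ G = fun x => -F x) ∧ SegmentAffine G ∧ (∃ y, 0 < G y) ∧
      (∃ y, G y < 0) ∧ (∀ x, 0 < G x → x ∈ A) ∧ ∀ x, G x < 0 → x ∉ A := by
  obtain ⟨x, hx⟩ := hne
  obtain ⟨s, hs⟩ := hfr
  have hx' : F (s + (-1 : ℝ) • (x - s)) = -F x := by
    rw [hF, hsub s hs]; ring
  obtain ⟨⟨y, hy⟩, y', hy'⟩ : (∃ y, 0 < F y) ∧ ∃ y, F y < 0 := by
    rcases lt_or_gt_of_ne hx with h | h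
    · exact ⟨⟨_, by rw [hx']; linarith⟩, x, h⟩
    · exact ⟨⟨x, h⟩, _, by rw [hx']; linarith⟩
  have side : ∀ G : Heis → ℝ, SegmentAffine G → (∀ x ∈ frontier A, G x = 0) →
      {x | 0 < G x} ⊆ interior A ∨ {x | 0 < G x} ⊆ interior Aᶜ := by
    intro G hG hG0
    refine hG.isPreconnected_pos.subset_or_subset isOpen_interior isOpen_interior ?_ ?_
    · exact Disjoint.mono interior_subset interior_subset disjoint_compl_right
    · intro z hz
      exact mem_interior_or_of_notMem_frontier fun h => (ne_of_gt hz) (hG0 z h)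
  have noboth : ∀ B : Set Heis, (interior Bᶜ).Nonempty → {x | 0 < F x} ⊆ interior B →
      {x | 0 < -F x} ⊆ interior B → False := by
    rintro B ⟨z, hz⟩ h h'
    have hzB : z ∉ closure B := by rwa [interior_compl] at hz
    rcases le_total 0 (F z) with hz0 | hz0
    · exact hzB (closure_mono (h.trans interior_subset) (hF.mem_closure_pos hy hz0))
    · exact hzB (closure_mono (h'.trans interior_subset)
        (hF.neg.mem_closure_pos (y := y') (by simpa using hy') (by simpa using hz0)))
  rcases side F hF hsub with h | h <;>
    rcases side _ hF.neg (fun x hx => by simp [hsub x hx]) with h' | h'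
  · exact (noboth A hB h h').elim
  · exact ⟨F, Or.inl rfl, hF, ⟨y, hy⟩, ⟨y', hy'⟩, fun x hx => interior_subset (h hx),
      fun x hx => interior_subset (h' (by simpa using hx))⟩
  · exact ⟨fun x => -F x, Or.inr rfl, hF.neg, ⟨y', by simpa using hy'⟩, ⟨y, by simpa using hy⟩,
      fun x hx => interior_subset (h' hx), fun x hx => interior_subset (h (by simpa using hx))⟩
  · exact (noboth Aᶜ (by rwa [compl_compl]) h h').elim

lemma segmentAffine_horForm (g : Heis) : SegmentAffine (horForm g) :=
  fun p q t => horForm_segment g p q t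

lemma segmentAffine_planarDet (d : ℝ × ℝ) (g : Heis) :
    SegmentAffine fun x => planarDet d (x.1 - g.1, x.2.1 - g.2.1) := by
  intro p q t
  simp only [planarDet, Prod.fst_add, Prod.snd_add, Prod.smul_fst, Prod.smul_snd, Prod.fst_sub,
    Prod.snd_sub, smul_eq_mul]
  ring

/-- A horizontally convex set with horizontally convex complement has a plane as its frontier. -/
lemma HorConvex.exists_plane {A : Set Heis} (hA : HorConvex A) (hB : HorConvex Aᶜ)
    (hne : A.Nonempty) (hne' : Aᶜ.Nonempty) :
    ∃ G : Heis → ℝ, Continuous G ∧ SegmentAffine G ∧ (∃ y, 0 < G y) ∧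
      frontier A = {x | G x = 0} ∧ {x | 0 < G x} ⊆ A ∧ A ⊆ closure {x | 0 < G x} ∧
      ((∃ g, ∀ x, G x = 0 ↔ horForm g x = 0) ∨
        ∃ (d : ℝ × ℝ) (g : Heis), d ≠ 0 ∧
          ∀ x, G x = 0 ↔ planarDet d (x.1 - g.1, x.2.1 - g.2.1) = 0) := by
  have hiA := hA.interior_nonempty hB hne
  have hiB := hB.interior_nonempty (by rwa [compl_compl]) hne'
  have hfr : (frontier A).Nonempty := nonempty_frontier_iff.2 ⟨hne, nonempty_compl.1 hne'⟩
  have hfu : frontier A ≠ univ := by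
    obtain ⟨x, hx⟩ := hiA
    exact fun h => (h ▸ mem_univ x : x ∈ frontier A).2 hx
  obtain ⟨p, hp⟩ := hfr
  obtain ⟨F, cF, hF, hF0, hsub, hplane⟩ : ∃ F : Heis → ℝ, Continuous F ∧ SegmentAffine F ∧
      (∃ x, F x ≠ 0) ∧ (∀ x ∈ frontier A, F x = 0) ∧
      ((∃ g, ∀ x, F x = 0 ↔ horForm g x = 0) ∨
        ∃ (d : ℝ × ℝ) (g : Heis), d ≠ 0 ∧
          ∀ x, F x = 0 ↔ planarDet d (x.1 - g.1, x.2.1 - g.2.1) = 0) := by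
    rcases (hA.lineClosed_frontier hB).subset_plane isClosed_frontier hfu
      (fun s hs => hA.exists_horLine_subset_frontier hB hs) hp with ⟨g, -, hg⟩ | ⟨d, hd0, hd⟩
    · refine ⟨horForm g, ?_, segmentAffine_horForm g, ⟨(g.1, g.2.1, g.2.2 + 1), ?_⟩, hg,
        Or.inl ⟨g, fun _ => Iff.rfl⟩⟩
      · unfold horForm; fun_prop
      · simp only [horForm]; ring_nf; exact one_ne_zero
    · refine ⟨_, ?_, segmentAffine_planarDet d p, ⟨(p.1 - d.2, p.2.1 + d.1, 0), ?_⟩, hd,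
        Or.inr ⟨d, p, hd0, fun _ => Iff.rfl⟩⟩
      · unfold planarDet; fun_prop
      · simp only [planarDet]
        intro h
        refine hd0 (Prod.ext ?_ ?_) <;> simp only [Prod.fst_zero, Prod.snd_zero] <;>
          nlinarith [sq_nonneg d.1, sq_nonneg d.2]
  obtain ⟨G, hG, hGa, ⟨y, hy⟩, ⟨y', hy'⟩, hpos, hneg⟩ := hF.exists_sides hF0 ⟨p, hp⟩ hsub hiA hiB
  have hGF : ∀ x, G x = 0 ↔ F x = 0 := by
    rcases hG with rfl | rfl <;> simp
  have cG : Continuous G := by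
    rcases hG with rfl | rfl
    · exact cF
    · exact cF.neg
  have hnn : ∀ x ∈ A, 0 ≤ G x := fun x hx => by
    by_contra h
    exact hneg x (not_le.1 h) hx
  refine ⟨G, cG, hGa, ⟨y, hy⟩, ?_, hpos, fun x hx => hGa.mem_closure_pos hy (hnn x hx), ?_⟩
  · refine Subset.antisymm (fun x hx => (hGF x).2 (hsub x hx)) fun x hx => ?_
    rw [frontier_eq_closure_inter_closure]
    refine ⟨closure_mono hpos (hGa.mem_closure_pos hy (le_of_eq (Eq.symm hx))), ?_⟩
    refine closure_mono (fun z hz => hneg z ?_)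
      (hGa.neg.mem_closure_pos (y := y') (by simpa using hy') (neg_nonneg.2 (le_of_eq hx)))
    simpa using hz
  · simpa only [hGF] using hplane

lemma connectedComponentIn_eq_pos {X : Type*} [TopologicalSpace X] {G : X → ℝ} (hG : Continuous G)
    (hpos : IsPreconnected {x | 0 < G x}) {y : X} (hy : 0 < G y) :
    connectedComponentIn {x | G x = 0}ᶜ y = {x | 0 < G x} := by
  have hy0 : y ∈ {x | G x = 0}ᶜ := ne_of_gt hy
  refine Subset.antisymm (fun x hx => ?_)
    (hpos.subset_connectedComponentIn hy fun x hx => ne_of_gt hx)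
  have hx0 : G x ≠ 0 := connectedComponentIn_subset _ _ hx
  by_contra h
  obtain ⟨z, hz, hz0⟩ := isPreconnected_connectedComponentIn.intermediate_value hx
    (mem_connectedComponentIn hy0) hG.continuousOn ⟨not_lt.1 h, hy.le⟩
  exact connectedComponentIn_subset _ _ hz hz0

/-- The coordinates `(x, y, w) = (a, b, 2 * c - a * b)`, in which horizontal lines are straight. -/
def straighten : Heis ≃ₜ Heis where
  toFun p := (p.1, p.2.1, 2 * p.2.2 - p.1 * p.2.1)
  invFun p := (p.1, p.2.1, (p.2.2 + p.1 * p.2.1) / 2)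
  left_inv p := by
    refine Prod.ext rfl (Prod.ext rfl ?_)
    simp only; ring
  right_inv p := by
    refine Prod.ext rfl (Prod.ext rfl ?_)
    simp only; ring
  continuous_toFun := by fun_prop
  continuous_invFun := by fun_prop

lemma straighten_hMul (g : Heis) (a b t : ℝ) :
    straighten (hMul g (t * a, t * b, t ^ 2 * a * b / 2)) =
      horLine (straighten g) (a, b) t := by
  simp only [straighten, hMul, horLine, Homeomorph.homeomorph_mk_coe, Equiv.coe_fn_mk]
  refine Prod.ext rfl (Prod.ext rfl ?_)
  simp only; ring

lemma mem_hLine_iff {g p : Heis} {a b : ℝ} :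
    p ∈ hLine g a b ↔ ∃ t, straighten p = horLine (straighten g) (a, b) t := by
  simp only [hLine, mem_ofPred_eq, ← straighten_hMul, straighten.injective.eq_iff]

lemma horConvex_preimage_straighten {E : Set Heis}
    (hE : ∀ L, IsLine L → IsPreconnected (L ∩ E)) : HorConvex (straighten.symm ⁻¹' E) := by
  intro p hp q hq hpq t ht0 ht1
  rcases eq_or_ne p q with rfl | hne
  · simpa using hp
  set v : ℝ × ℝ := (q.1 - p.1, q.2.1 - p.2.1) with hv
  have hv0 : ¬(v.1 = 0 ∧ v.2 = 0) := by
    rintro ⟨h1, h2⟩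
    exact hne (eq_of_horForm_eq_zero hpq (sub_eq_zero.1 h1).symm (sub_eq_zero.1 h2).symm)
  have hn : v.1 ^ 2 + v.2 ^ 2 ≠ 0 := by
    intro h
    apply hv0
    constructor <;> nlinarith [sq_nonneg v.1, sq_nonneg v.2]
  have hL := hE _ ⟨straighten.symm p, v.1, v.2, hv0, rfl⟩
  set f : Heis → ℝ := fun x =>
    (v.1 * (x.1 - p.1) + v.2 * (x.2.1 - p.2.1)) / (v.1 ^ 2 + v.2 ^ 2) with hf
  have hfl : ∀ x : Heis, ∀ s, straighten x = horLine p v s → f x = s := by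
    intro x s hx
    have e1 : x.1 = p.1 + s * v.1 := congrArg (fun x : Heis => x.1) hx
    have e2 : x.2.1 = p.2.1 + s * v.2 := congrArg (fun x : Heis => x.2.1) hx
    simp only [hf]
    rw [e1, e2, div_eq_iff hn]
    ring
  have hmem : ∀ s, straighten.symm (horLine p v s) ∈ E →
      s ∈ f '' (hLine (straighten.symm p) v.1 v.2 ∩ E) := fun s hs =>
    ⟨_, ⟨mem_hLine_iff.2 ⟨s, by simp⟩, hs⟩, hfl _ _ (by simp)⟩
  have h0 := hmem 0 (by rw [horLine_zero]; exact hp)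
  have hq1 : horLine p v 1 = q := by
    have := horLine_sub hpq 1
    rw [one_smul, add_sub_cancel] at this
    exact this
  have h1 := hmem 1 (by rw [hq1]; exact hq)
  obtain ⟨x, ⟨hxL, hxE⟩, hxt⟩ := (hL.image f (by fun_prop)).ordConnected.out h0 h1 ⟨ht0, ht1⟩
  obtain ⟨s, hs⟩ := mem_hLine_iff.1 hxL
  rw [Homeomorph.apply_symm_apply] at hs
  have := hfl x s hs
  rw [← horLine_sub hpq, mem_preimage]
  rw [hxt] at this
  subst this
  rw [← hs, Homeomorph.symm_apply_apply]
  exact hxE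

lemma horizPlane_eq (g : Heis) :
    horizPlane g = {x | horForm (straighten g) (straighten x) = 0} := by
  ext x
  constructor
  · rintro ⟨_, ⟨k, a, b, -, rfl⟩, hg, hx⟩
    obtain ⟨s, hs⟩ := mem_hLine_iff.1 hg
    obtain ⟨t, ht⟩ := mem_hLine_iff.1 hx
    rw [mem_ofPred_eq, hs, ht]
    exact horForm_horLine _ _ _ _
  · intro hx
    rcases eq_or_ne (straighten g) (straighten x) with h | h
    · refine ⟨hLine g 1 0, ⟨g, 1, 0, by simp, rfl⟩, mem_hLine_iff.2 ⟨0, ?_⟩,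
        mem_hLine_iff.2 ⟨0, ?_⟩⟩
      · rw [horLine_zero]
      · rw [horLine_zero, h]
    · refine ⟨hLine g (x.1 - g.1) (x.2.1 - g.2.1), ⟨g, _, _, ?_, rfl⟩,
        mem_hLine_iff.2 ⟨0, ?_⟩, mem_hLine_iff.2 ⟨1, ?_⟩⟩
      · rintro ⟨h1, h2⟩
        exact h (eq_of_horForm_eq_zero hx (sub_eq_zero.1 h1).symm (sub_eq_zero.1 h2).symm)
      · rw [horLine_zero]
      · have := horLine_sub hx 1
        rw [one_smul, add_sub_cancel] at this
        exact this.symm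

lemma isPlane_vertical {d : ℝ × ℝ} (hd : d ≠ 0) (g : Heis) :
    IsPlane {x | planarDet d (x.1 - g.1, x.2.1 - g.2.1) = 0} := by
  refine Or.inl ⟨{q | ∃ t : ℝ, q = hPi g + t • d}, ⟨hPi g, d, hd, rfl⟩, ?_⟩
  ext x
  constructor
  · intro hx
    obtain ⟨c, hc⟩ := exists_smul_of_planarDet_eq_zero hd hx
    refine ⟨c, ?_⟩
    rw [← hc]
    simp [hPi]
  · rintro ⟨t, ht⟩
    have e1 : x.1 = g.1 + t * d.1 := congrArg (fun x : ℝ × ℝ => x.1) ht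
    have e2 : x.2.1 = g.2.1 + t * d.2 := congrArg (fun x : ℝ × ℝ => x.2) ht
    simp only [mem_ofPred_eq, planarDet, e1, e2]
    ring

/-- If `E ⊆ H` is precisely monotone and both `E` and `Eᶜ` are nonempty, then `∂E` is
a plane and `C ⊆ E ⊆ closure C` for a connected component `C` of `H∖∂E`. -/
theorem statement16 (E : Set Heis) (hE : IsPreciselyMonotone E)
    (h1 : E.Nonempty) (h2 : Eᶜ.Nonempty) :
    IsPlane (frontier E) ∧
      ∃ x ∈ (frontier E)ᶜ,
        connectedComponentIn (frontier E)ᶜ x ⊆ E ∧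
        E ⊆ closure (connectedComponentIn (frontier E)ᶜ x) := by
  have hA := horConvex_preimage_straighten fun L hL => (hE L hL).1
  have hB := horConvex_preimage_straighten fun L hL => (hE L hL).2
  obtain ⟨G, cG, hG, ⟨y, hy⟩, hfr, hsub, hcl, hpl⟩ := hA.exists_plane hB
    (h1.preimage straighten.symm.surjective) (h2.preimage straighten.symm.surjective)
  have hEA : straighten ⁻¹' (straighten.symm ⁻¹' E) = E := by
    rw [← preimage_comp]; simp
  have hfrE : frontier E = {x | G (straighten x) = 0} := by
    rw [← hEA, ← straighten.preimage_frontier, hfr]; rfl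
  have hcomp := connectedComponentIn_eq_pos (cG.comp straighten.continuous)
    (straighten.isPreconnected_preimage.2 hG.isPreconnected_pos)
    (y := straighten.symm y) (by simpa using hy)
  refine ⟨?_, straighten.symm y, ?_, ?_⟩
  · rw [hfrE]
    rcases hpl with ⟨g, hg⟩ | ⟨d, g, hd, hg⟩
    · refine Or.inr ⟨straighten.symm g, ?_⟩
      simp only [horizPlane_eq, hg, Homeomorph.apply_symm_apply]
    · simp only [hg]
      exact isPlane_vertical hd g
  · rw [hfrE]
    simpa using hy.ne'
  · rw [hfrE]
    simp only [Function.comp_apply] at hcomp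
    rw [hcomp]
    refine ⟨fun x hx => ?_, ?_⟩
    · simpa using hsub hx
    · have := preimage_mono (f := straighten) hcl
      rwa [hEA, straighten.preimage_closure] at this
end
end

section
/- For x ∈ H let P_x denote the horizontal plane centered at x, and for a horizontal pair (x₁,x₂) lying on a line L let (x₁,x₂) ⊂ L denote the open segment of L strictly between x₁ and x₂, and set P_{x₁,x₂} := {y ∈ H : P_y ∩ (x₁,x₂) ≠ ∅}. Let Σ be a signed Radon measure on H (regarded as a signed measure on horizontal planes via the identification x ↔ P_x) which is Lipschitz: there is a constant C such that |Σ|(P_{x₁,x₂}) ≤ C·d(x₁,x₂) for every horizontal pair (x₁,x₂), where |Σ| is the total variation measure and d is the Carnot–Carathéodory distance. If for Lebesgue-almost every parametrized horizontal pair — i.e. for a.e. (g,(a,b),s,t) ∈ H × (ℝ²∖{0}) × ℝ × ℝ, taking x₁ = γ(s), x₂ = γ(t) with γ(u) = g·(ua, ub, u²ab/2) — one has Σ(P_{x₁,x₂}) = 0, then Σ = 0. -/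
open MeasureTheory Set Topology Filter

noncomputable section

/-- A Lipschitz path `c : [0,1] → H` is horizontal with (a.e.) component derivatives
`v₁, v₂` if `c₁' = v₁`, `c₂' = v₂` and `c₃'(t) = c₁(t)·c₂'(t)` hold almost everywhere
on `[0,1]`. -/
def IsHorizPath (c : ℝ → Heis) (v₁ v₂ : ℝ → ℝ) : Prop :=
  ∀ᵐ t ∂(volume : Measure ℝ), t ∈ Icc (0 : ℝ) 1 →
    HasDerivAt (fun u => (c u).1) (v₁ t) t ∧
    HasDerivAt (fun u => (c u).2.1) (v₂ t) t ∧
    HasDerivAt (fun u => (c u).2.2) ((c t).1 * v₂ t) t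

/-- The length `∫₀¹ √(c₁'(t)² + c₂'(t)²) dt` of a horizontal path. -/
def pathLen (v₁ v₂ : ℝ → ℝ) : ℝ :=
  ∫ t in (0 : ℝ)..1, Real.sqrt (v₁ t ^ 2 + v₂ t ^ 2)

/-- The Carnot–Carathéodory distance on the Heisenberg group: the infimum of lengths
of Lipschitz horizontal paths joining the two points. -/
def ccDist (x y : Heis) : ℝ :=
  sInf { l : ℝ | ∃ c : ℝ → Heis, ∃ v₁ v₂ : ℝ → ℝ,
    (∃ K : NNReal, LipschitzOnWith K c (Icc 0 1)) ∧
    IsHorizPath c v₁ v₂ ∧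
    IntervalIntegrable (fun t => Real.sqrt (v₁ t ^ 2 + v₂ t ^ 2)) volume 0 1 ∧
    c 0 = x ∧ c 1 = y ∧ l = pathLen v₁ v₂ }

/-- The parametrized line `t ↦ g·(ta, tb, t²ab/2)`. -/
def lineMap' (g : Heis) (a b t : ℝ) : Heis := hMul g (t * a, t * b, t ^ 2 * a * b / 2)

/-- `P_{x₁,x₂}`: the union of the horizontal planes centered at points of the open
segment of the line between `x₁ = γ(s)` and `x₂ = γ(t)`. -/
def Pbetween (g : Heis) (a b s t : ℝ) : Set Heis :=
  {y | ∃ u ∈ Set.uIoo s t, y ∈ horizPlane (lineMap' g a b u)}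

/-- The function whose zero set is the horizontal plane centered at `x`. -/
def hForm (x y : Heis) : ℝ :=
  y.2.2 - x.2.2 - (x.1 + y.1) * (y.2.1 - x.2.1) / 2

theorem continuous_hForm : Continuous fun p : Heis × Heis => hForm p.1 p.2 := by
  unfold hForm
  fun_prop

theorem measurable_hForm (x : Heis) : Measurable (hForm x) :=
  (continuous_hForm.comp (Continuous.prodMk_right x)).measurable

theorem hForm_lineMap' (g y : Heis) (a b u : ℝ) :
    hForm (lineMap' g a b u) y =
      hForm g y - u * (a * (y.2.1 - g.2.1) - b * (y.1 - g.1)) / 2 := by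
  simp only [hForm, lineMap', hMul]
  ring

theorem mem_horizPlane_iff (x y : Heis) : y ∈ horizPlane x ↔ hForm x y = 0 := by
  constructor
  · rintro ⟨L, ⟨g, a, b, -, rfl⟩, ⟨t, rfl⟩, ⟨s, rfl⟩⟩
    simp only [hForm, hMul]
    ring
  · intro h
    by_cases h0 : y.1 - x.1 = 0 ∧ y.2.1 - x.2.1 = 0
    · have hyx : y = x := by
        simp only [hForm, h0.2] at h
        ext <;> linarith [h0.1, h0.2]
      subst hyx
      have hy : y ∈ hLine y 1 0 := ⟨0, by ext <;> simp [hMul]⟩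
      exact ⟨_, ⟨y, 1, 0, by simp, rfl⟩, hy, hy⟩
    · refine ⟨_, ⟨x, _, _, h0, rfl⟩, ⟨0, by ext <;> simp [hMul]⟩, ⟨1, ?_⟩⟩
      simp only [hForm] at h
      ext <;> simp only [hMul] <;> linarith

/-- The double wedge of points `y` such that `hForm · y` changes sign between `x₁` and `x₂`. -/
def wedge (x₁ x₂ : Heis) : Set Heis := {y | hForm x₁ y * hForm x₂ y < 0}

theorem measurableSet_wedge (x₁ x₂ : Heis) : MeasurableSet (wedge x₁ x₂) :=
  measurableSet_lt ((measurable_hForm x₁).mul (measurable_hForm x₂)) measurable_const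

theorem Pbetween_eq (g : Heis) (a b s t : ℝ) (hst : s ≠ t) :
    Pbetween g a b s t = wedge (lineMap' g a b s) (lineMap' g a b t) ∪
      ({y | hForm (lineMap' g a b s) y = 0} ∩ {y | hForm (lineMap' g a b t) y = 0}) := by
  wlog h : s < t generalizing s t
  · have := this t s hst.symm (lt_of_le_of_ne (not_lt.1 h) hst.symm)
    unfold Pbetween wedge at this ⊢
    simp_rw [uIoo_comm s t, this, mul_comm, inter_comm]
  ext y
  simp only [Pbetween, wedge, uIoo_of_lt h, mem_Ioo, mem_horizPlane_iff, hForm_lineMap', mem_union,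
    mem_inter_iff, mem_ofPred_eq]
  set A := hForm g y
  set B := a * (y.2.1 - g.2.1) - b * (y.1 - g.1)
  constructor
  · rintro ⟨u, ⟨hu₁, hu₂⟩, hu⟩
    have hA : A = u * B / 2 := by linarith
    by_cases hB : B = 0
    · right
      simp [hA, hB]
    · left
      have : 0 < B ^ 2 := by positivity
      have h1 : 0 < (u - s) * (t - u) := mul_pos (by linarith) (by linarith)
      rw [hA]
      nlinarith [mul_pos h1 this]
  · rintro (h1 | ⟨h1, h2⟩)
    · have hB : B ≠ 0 := by
        intro hB
        rw [hB] at h1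
        nlinarith [sq_nonneg A]
      have hB2 : 0 < B ^ 2 := by positivity
      set u := 2 * A / B
      have hA : A = u * B / 2 := by
        simp only [u]
        field_simp
      rw [hA] at h1
      have h3 : (u - s) * (u - t) < 0 := by
        by_contra! h4
        nlinarith [mul_nonneg h4 hB2.le]
      refine ⟨u, ?_, by linarith⟩
      constructor <;> by_contra! h5 <;> nlinarith
    · have hB : B = 0 := by
        have : (t - s) * B = 0 := by linarith
        exact (mul_eq_zero.1 this).resolve_left (by linarith)
      refine ⟨(s + t) / 2, ⟨by linarith, by linarith⟩, ?_⟩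
      rw [hB] at h1 ⊢
      linarith

theorem measurableSet_hForm_eq_zero (x : Heis) : MeasurableSet {y | hForm x y = 0} :=
  measurableSet_eq_fun (measurable_hForm x) measurable_const

theorem measurableSet_Pbetween (g : Heis) (a b s t : ℝ) (hst : s ≠ t) :
    MeasurableSet (Pbetween g a b s t) := by
  rw [Pbetween_eq g a b s t hst]
  exact (measurableSet_wedge _ _).union
    ((measurableSet_hForm_eq_zero _).inter (measurableSet_hForm_eq_zero _))

theorem measure_Pbetween {μ : Measure Heis} (h₀ : ∀ x, μ {y | hForm x y = 0} = 0)
    (g : Heis) (a b s t : ℝ) (hst : s ≠ t) :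
    μ (Pbetween g a b s t) = μ (wedge (lineMap' g a b s) (lineMap' g a b t)) := by
  rw [Pbetween_eq g a b s t hst]
  exact measure_congr (union_ae_eq_left_of_ae_eq_empty
    (ae_eq_empty.2 (measure_mono_null inter_subset_left (h₀ _))))

/-- The measure of a wedge depends continuously on the two centers when planes are null. -/
theorem continuous_measureReal_wedge {μ : Measure Heis} [IsFiniteMeasure μ]
    (h₀ : ∀ x, μ {y | hForm x y = 0} = 0) :
    Continuous fun p : Heis × Heis => μ.real (wedge p.1 p.2) := by
  rw [continuous_iff_continuousAt]
  intro p
  refine (ENNReal.tendsto_toReal (measure_ne_top _ _)).comp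
    (tendsto_measure_of_ae_tendsto_indicator_of_isFiniteMeasure (𝓝 p) (measurableSet_wedge _ _)
      (fun q => measurableSet_wedge _ _) ?_)
  filter_upwards [measure_eq_zero_iff_ae_notMem.1 (h₀ p.1),
    measure_eq_zero_iff_ae_notMem.1 (h₀ p.2)] with y h1 h2
  have hc : Continuous fun q : Heis × Heis => hForm q.1 y * hForm q.2 y :=
    (continuous_hForm.comp (continuous_fst.prodMk continuous_const)).mul
      (continuous_hForm.comp (continuous_snd.prodMk continuous_const))
  rcases lt_or_gt_of_ne (mul_ne_zero h1 h2) with h | h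
  · filter_upwards [hc.continuousAt.eventually_lt_const h] with q hq
    exact iff_of_true hq h
  · filter_upwards [hc.continuousAt.eventually_const_lt h] with q hq
    exact iff_of_false (not_lt.2 hq.le) (not_lt.2 h.le)

theorem ccDist_le (g : Heis) (r : ℝ) (hr : 0 ≤ r) :
    ccDist (lineMap' g 1 0 (-r)) (lineMap' g 1 0 r) ≤ 2 * r := by
  refine csInf_le ⟨0, ?_⟩ ⟨fun t => (g.1 - r + 2 * r * t, g.2.1, g.2.2), fun _ => 2 * r,
    fun _ => 0, ?_, ?_, ?_, ?_, ?_, ?_⟩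
  · rintro _ ⟨c, v₁, v₂, -, -, -, -, -, rfl⟩
    exact intervalIntegral.integral_nonneg zero_le_one fun t _ => Real.sqrt_nonneg _
  · refine ⟨Real.nnabs (2 * r), LipschitzWith.lipschitzOnWith ?_⟩
    refine LipschitzWith.of_dist_le_mul fun s t => ?_
    simp only [Prod.dist_eq, dist_self, Real.dist_eq, Real.coe_nnabs]
    rw [← abs_mul]
    ring_nf
    simp
  · refine .of_forall fun t _ => ⟨?_, hasDerivAt_const _ _, by simpa using hasDerivAt_const t g.2.2⟩
    simpa using ((hasDerivAt_id t).const_mul (2 * r)).const_add (g.1 - r)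
  · simp
  · ext <;> simp [lineMap', hMul]
    ring
  · ext <;> simp [lineMap', hMul]
    ring
  · simp [pathLen, Real.sqrt_sq, hr]

theorem measure_hForm_eq_zero_of_lipschitz {μ : Measure Heis} (C : ℝ)
    (hLip : ∀ (g : Heis) (a b s t : ℝ), ¬(a = 0 ∧ b = 0) →
      μ (Pbetween g a b s t) ≤
        ENNReal.ofReal (C * ccDist (lineMap' g a b s) (lineMap' g a b t)))
    (x : Heis) : μ {y | hForm x y = 0} = 0 := by
  have hb : ∀ r : ℝ, 0 < r → μ {y | hForm x y = 0} ≤ ENNReal.ofReal (|C| * (2 * r)) := by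
    intro r hr
    have hsub : {y | hForm x y = 0} ⊆ Pbetween x 1 0 (-r) r := fun y hy =>
      ⟨0, by rw [uIoo_of_lt (by linarith)]; constructor <;> linarith,
        (mem_horizPlane_iff _ _).2 (by rw [hForm_lineMap']; simpa using hy)⟩
    have h0 : 0 ≤ ccDist (lineMap' x 1 0 (-r)) (lineMap' x 1 0 r) := by
      refine Real.sInf_nonneg ?_
      rintro _ ⟨c, v₁, v₂, -, -, -, -, -, rfl⟩
      exact intervalIntegral.integral_nonneg zero_le_one fun t _ => Real.sqrt_nonneg _
    refine (measure_mono hsub).trans ((hLip x 1 0 (-r) r (by simp)).trans ?_)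
    exact ENNReal.ofReal_le_ofReal (mul_le_mul (le_abs_self C) (ccDist_le x r hr.le) h0
      (abs_nonneg C))
  have hlim : Tendsto (fun r : ℝ => ENNReal.ofReal (|C| * (2 * r))) (𝓝[>] 0) (𝓝 0) := by
    have : Continuous fun r : ℝ => ENNReal.ofReal (|C| * (2 * r)) :=
      ENNReal.continuous_ofReal.comp (by fun_prop)
    simpa using (this.tendsto 0).mono_left nhdsWithin_le_nhds
  exact le_antisymm (ge_of_tendsto hlim (by filter_upwards [self_mem_nhdsWithin] using hb)) bot_le

/-- The position of `y` as seen from `x`: the line in `horizPlane x` along which it meets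
`horizPlane y`, in dual coordinates. -/
def hSlope (x y : Heis) : ℝ × ℝ :=
  ((y.1 - x.1) / hForm x y, (y.2.1 - x.2.1) / hForm x y)

theorem measurable_hSlope (x : Heis) : Measurable (hSlope x) :=
  ((measurable_fst.sub_const _).div (measurable_hForm x)).prodMk
    (((measurable_fst.comp measurable_snd).sub_const _).div (measurable_hForm x))

theorem hForm_lineMap'_one (x y : Heis) (p q c : ℝ) (hc : c ≠ 0) (hy : hForm x y ≠ 0) :
    hForm (lineMap' x (2 * q / c) (-2 * p / c) 1) y =
      hForm x y * (1 - (p * (hSlope x y).1 + q * (hSlope x y).2) / c) := by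
  rw [hForm_lineMap']
  simp only [hSlope]
  field_simp
  ring

theorem wedge_eq_lt_hSlope (x : Heis) (p q c : ℝ) (hc : 0 < c) :
    wedge x (lineMap' x (2 * q / c) (-2 * p / c) 1) =
      {y | c < p * (hSlope x y).1 + q * (hSlope x y).2} := by
  ext y
  simp only [wedge, mem_ofPred_eq]
  by_cases hy : hForm x y = 0
  · simp [hSlope, hy, hc.le]
  · have h2 : 0 < hForm x y ^ 2 := by positivity
    rw [hForm_lineMap'_one x y p q c hc.ne' hy, ← mul_assoc, ← sq, ← one_lt_div hc]
    exact ⟨fun h => sub_neg.1 (neg_of_mul_neg_right h h2.le),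
      fun h => mul_neg_of_pos_of_neg h2 (sub_neg.2 h)⟩

section Uniqueness

variable {μ ν : Measure Heis}

theorem measure_lt_hSlope
    (h : ∀ x a b, μ (wedge x (lineMap' x a b 1)) = ν (wedge x (lineMap' x a b 1)))
    (x : Heis) (p q c : ℝ) (hc : 0 < c) :
    μ {y | c < p * (hSlope x y).1 + q * (hSlope x y).2} =
      ν {y | c < p * (hSlope x y).1 + q * (hSlope x y).2} := by
  rw [← wedge_eq_lt_hSlope x p q c hc, h]

theorem measure_pos_hSlope
    (h : ∀ x a b, μ (wedge x (lineMap' x a b 1)) = ν (wedge x (lineMap' x a b 1)))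
    (x : Heis) (p q : ℝ) :
    μ {y | 0 < p * (hSlope x y).1 + q * (hSlope x y).2} =
      ν {y | 0 < p * (hSlope x y).1 + q * (hSlope x y).2} := by
  have hU : {y | 0 < p * (hSlope x y).1 + q * (hSlope x y).2} =
      ⋃ n : ℕ, {y | 1 / ((n : ℝ) + 1) < p * (hSlope x y).1 + q * (hSlope x y).2} := by
    ext y
    simp only [mem_ofPred_eq, mem_iUnion]
    exact ⟨exists_nat_one_div_lt, fun ⟨n, hn⟩ => lt_trans (by positivity) hn⟩
  have hm : Monotone fun n : ℕ =>
      {y | 1 / ((n : ℝ) + 1) < p * (hSlope x y).1 + q * (hSlope x y).2} := fun m n hmn y hy => by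
    simp only [mem_ofPred_eq] at hy ⊢
    exact lt_of_le_of_lt (Nat.one_div_le_one_div hmn) hy
  rw [hU, hm.measure_iUnion, hm.measure_iUnion]
  exact iSup_congr fun n => measure_lt_hSlope h x p q _ (by positivity)

theorem measure_hSlope_eq (h₀ : ∀ x, μ {y | hForm x y = 0} = 0)
    (x : Heis) (p q c : ℝ) (hc : c ≠ 0) :
    μ {y | p * (hSlope x y).1 + q * (hSlope x y).2 = c} = 0 := by
  refine measure_mono_null (fun y hy => ?_) (h₀ (lineMap' x (2 * q / c) (-2 * p / c) 1))
  simp only [mem_ofPred_eq] at hy ⊢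
  have hF : hForm x y ≠ 0 := by
    intro hF
    apply hc
    rw [← hy]
    simp [hSlope, hF]
  rw [hForm_lineMap'_one x y p q c hc hF, hy, div_self hc]
  simp

theorem measure_le_hSlope (hμ : ∀ x, μ {y | hForm x y = 0} = 0)
    (hν : ∀ x, ν {y | hForm x y = 0} = 0)
    (h : ∀ x a b, μ (wedge x (lineMap' x a b 1)) = ν (wedge x (lineMap' x a b 1)))
    (x : Heis) (p q c : ℝ) (hc : 0 < c) :
    μ {y | c ≤ p * (hSlope x y).1 + q * (hSlope x y).2} =
      ν {y | c ≤ p * (hSlope x y).1 + q * (hSlope x y).2} := by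
  have hU : {y | c ≤ p * (hSlope x y).1 + q * (hSlope x y).2} =
      {y | c < p * (hSlope x y).1 + q * (hSlope x y).2} ∪
        {y | p * (hSlope x y).1 + q * (hSlope x y).2 = c} := by
    ext y
    simp [le_iff_lt_or_eq, eq_comm]
  have key : ∀ {ρ : Measure Heis}, (∀ x, ρ {y | hForm x y = 0} = 0) →
      ρ {y | c ≤ p * (hSlope x y).1 + q * (hSlope x y).2} =
        ρ {y | c < p * (hSlope x y).1 + q * (hSlope x y).2} := fun {ρ} hρ => by
    rw [hU]
    exact measure_congr (union_ae_eq_left_of_ae_eq_empty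
      (ae_eq_empty.2 (measure_hSlope_eq hρ x p q c hc.ne')))
  rw [key hμ, key hν, measure_lt_hSlope h x p q c hc]

variable [IsFiniteMeasure μ] [IsFiniteMeasure ν]

theorem measure_univ_eq_of_wedge (hμ : ∀ x, μ {y | hForm x y = 0} = 0)
    (hν : ∀ x, ν {y | hForm x y = 0} = 0)
    (h : ∀ x a b, μ (wedge x (lineMap' x a b 1)) = ν (wedge x (lineMap' x a b 1))) :
    μ univ = ν univ := by
  obtain ⟨α, hα⟩ : ∃ α : ℝ, α ∉ {t | 0 < μ {y : Heis | y.1 = t}} ∪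
      {t | 0 < ν {y : Heis | y.1 = t}} := by
    by_contra! hcon
    have hc := (Measure.countable_meas_level_set_pos (μ := μ) (g := (Prod.fst : Heis → ℝ))
      measurable_fst).union (Measure.countable_meas_level_set_pos (μ := ν)
        (g := (Prod.fst : Heis → ℝ)) measurable_fst)
    exact not_countable_univ (hc.mono fun t _ => hcon t)
  simp only [mem_union, mem_ofPred_eq, not_or, not_lt, nonpos_iff_eq_zero] at hα
  set x : Heis := (α, 0, 0)
  have key : ∀ {ρ : Measure Heis}, (∀ x, ρ {y | hForm x y = 0} = 0) → ρ {y | y.1 = α} = 0 →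
      ρ univ = ρ {y | 0 < 1 * (hSlope x y).1 + 0 * (hSlope x y).2} +
        ρ {y | 0 < -1 * (hSlope x y).1 + 0 * (hSlope x y).2} := fun {ρ} hρ hα => by
    have hmeas : Measurable fun y => -1 * (hSlope x y).1 + 0 * (hSlope x y).2 := by
      have h1 := (measurable_hSlope x).fst
      have h2 := (measurable_hSlope x).snd
      fun_prop
    rw [← measure_union ?_ (measurableSet_lt measurable_const hmeas)]
    · refine measure_congr ?_
      filter_upwards [measure_eq_zero_iff_ae_notMem.1 (hρ x),
        measure_eq_zero_iff_ae_notMem.1 hα] with y h1 h2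
      refine propext (iff_of_true trivial ?_)
      have : (hSlope x y).1 ≠ 0 := div_ne_zero (sub_ne_zero.2 h2) h1
      rcases lt_or_gt_of_ne this with h | h
      · right
        rw [mem_ofPred_eq]
        linarith
      · left
        rw [mem_ofPred_eq]
        linarith
    · rw [Set.disjoint_left]
      intro y h1 h2
      simp only [mem_ofPred_eq] at h1 h2
      linarith
  rw [key hμ hα.1, key hν hα.2, measure_pos_hSlope h, measure_pos_hSlope h]

theorem map_hSlope_eq (hμ : ∀ x, μ {y | hForm x y = 0} = 0)
    (hν : ∀ x, ν {y | hForm x y = 0} = 0)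
    (h : ∀ x a b, μ (wedge x (lineMap' x a b 1)) = ν (wedge x (lineMap' x a b 1)))
    (x : Heis) : μ.map (hSlope x) = ν.map (hSlope x) := by
  refine Measure.ext_of_charFunDual (funext fun L => ?_)
  rw [charFunDual_eq_charFun_map_one, charFunDual_eq_charFun_map_one]
  congr 1
  have hms := measurable_hSlope x
  have hL : ∀ z : ℝ × ℝ, L z = L (1, 0) * z.1 + L (0, 1) * z.2 := fun z => by
    conv_lhs => rw [show z = z.1 • ((1, 0) : ℝ × ℝ) + z.2 • (0, 1) by ext <;> simp]
    rw [map_add, map_smul, map_smul]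
    simp [mul_comm]
  refine Measure.ext_of_Iic _ _ fun c => ?_
  have hLm : Measurable L := L.continuous.measurable
  rw [Measure.map_map hLm hms, Measure.map_map hLm hms,
    Measure.map_apply (hLm.comp hms) measurableSet_Iic,
    Measure.map_apply (hLm.comp hms) measurableSet_Iic]
  rcases lt_or_ge c 0 with hc | hc
  · have : (L ∘ hSlope x) ⁻¹' Iic c =
        {y | -c ≤ -L (1, 0) * (hSlope x y).1 + -L (0, 1) * (hSlope x y).2} := by
      ext y
      simp only [mem_preimage, Function.comp, mem_Iic, hL (hSlope x y), mem_ofPred_eq]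
      constructor <;> intro <;> linarith
    rw [this]
    exact measure_le_hSlope hμ hν h x _ _ _ (neg_pos.2 hc)
  · have hS : (L ∘ hSlope x) ⁻¹' Iic c =
        {y | c < L (1, 0) * (hSlope x y).1 + L (0, 1) * (hSlope x y).2}ᶜ := by
      ext y
      simp [hL (hSlope x y)]
    have hm : MeasurableSet {y | c < L (1, 0) * (hSlope x y).1 + L (0, 1) * (hSlope x y).2} := by
      rw [← MeasurableSet.compl_iff, ← hS]
      exact hLm.comp hms measurableSet_Iic
    rw [hS, measure_compl hm (measure_ne_top _ _), measure_compl hm (measure_ne_top _ _),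
      measure_univ_eq_of_wedge hμ hν h]
    congr 1
    rcases hc.eq_or_lt with rfl | hc
    · exact measure_pos_hSlope h x _ _
    · exact measure_lt_hSlope h x _ _ _ hc

/-- Exponential coordinates on the Heisenberg group, in which horizontal planes are affine
planes. -/
def expCoord : Heis ≃ᵐ Heis where
  toFun y := (y.1, y.2.1, y.2.2 - y.1 * y.2.1 / 2)
  invFun y := (y.1, y.2.1, y.2.2 + y.1 * y.2.1 / 2)
  left_inv y := by ext <;> simp
  right_inv y := by ext <;> simp
  measurable_toFun := by simp only [Equiv.coe_fn_mk]; fun_prop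
  measurable_invFun := by simp only [Equiv.coe_fn_symm_mk]; fun_prop

/-- A phase measurable with respect to the projection from a point at distance `R` in the
horizontal direction `(w₁, w₂)` orthogonal to the frequency; it tends to the linear phase as
`R → ∞`. -/
theorem integral_projective_phase_eq (hμ : ∀ x, μ {y | hForm x y = 0} = 0)
    (hν : ∀ x, ν {y | hForm x y = 0} = 0)
    (h : ∀ x a b, μ (wedge x (lineMap' x a b 1)) = ν (wedge x (lineMap' x a b 1)))
    (k₁ k₂ k₃ w₁ w₂ : ℝ) (hw : w₁ ^ 2 + w₂ ^ 2 = 1) (hkw : k₁ * w₁ + k₂ * w₂ = 0) (R : ℝ) :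
    ∫ y, Complex.exp (↑(R * (k₁ * y.1 + k₂ * y.2.1 + k₃ * (y.2.2 - y.1 * y.2.1 / 2)) /
        (R - (w₁ * y.1 + w₂ * y.2.1))) * Complex.I) ∂μ =
      ∫ y, Complex.exp (↑(R * (k₁ * y.1 + k₂ * y.2.1 + k₃ * (y.2.2 - y.1 * y.2.1 / 2)) /
        (R - (w₁ * y.1 + w₂ * y.2.1))) * Complex.I) ∂ν := by
  set x : Heis := (R * w₁, R * w₂, R * w₁ * (R * w₂) / 2)
  set G : ℝ × ℝ → ℂ := fun η => Complex.exp (↑(R * (k₁ * η.1 + k₂ * η.2 +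
    k₃ * (1 + R * (w₁ * η.2 - w₂ * η.1) / 2)) / (-(w₁ * η.1 + w₂ * η.2))) * Complex.I)
  have hG : Measurable G := by fun_prop
  have key : ∀ {ρ : Measure Heis}, (∀ x, ρ {y | hForm x y = 0} = 0) →
      ∫ y, Complex.exp (↑(R * (k₁ * y.1 + k₂ * y.2.1 + k₃ * (y.2.2 - y.1 * y.2.1 / 2)) /
        (R - (w₁ * y.1 + w₂ * y.2.1))) * Complex.I) ∂ρ = ∫ η, G η ∂(ρ.map (hSlope x)) := by
    intro ρ hρ
    rw [integral_map (measurable_hSlope x).aemeasurable hG.aestronglyMeasurable]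
    refine integral_congr_ae ?_
    filter_upwards [measure_eq_zero_iff_ae_notMem.1 (hρ x)] with y hy
    have hF : hForm x y ≠ 0 := hy
    simp only [G, hSlope]
    congr 3
    have e1 : R * (k₁ * y.1 + k₂ * y.2.1 + k₃ * (y.2.2 - y.1 * y.2.1 / 2)) =
        R * (k₁ * ((y.1 - x.1) / hForm x y) + k₂ * ((y.2.1 - x.2.1) / hForm x y) +
          k₃ * (1 + R * (w₁ * ((y.2.1 - x.2.1) / hForm x y) -
            w₂ * ((y.1 - x.1) / hForm x y)) / 2)) * hForm x y := by
      field_simp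
      simp only [hForm, x]
      linear_combination 2 * R * R * hkw
    have e2 : R - (w₁ * y.1 + w₂ * y.2.1) = -(w₁ * ((y.1 - x.1) / hForm x y) +
        w₂ * ((y.2.1 - x.2.1) / hForm x y)) * hForm x y := by
      field_simp
      simp only [x]
      linear_combination (-R) * hw
    rw [e1, e2, mul_div_mul_right _ _ hF]
  rw [key hμ, key hν, map_hSlope_eq hμ hν h]

theorem tendsto_integral_projective_phase {ρ : Measure Heis} [IsFiniteMeasure ρ]
    (k₁ k₂ k₃ w₁ w₂ : ℝ) :
    Tendsto (fun R : ℕ => ∫ y, Complex.exp (↑(R * (k₁ * y.1 + k₂ * y.2.1 +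
      k₃ * (y.2.2 - y.1 * y.2.1 / 2)) / (R - (w₁ * y.1 + w₂ * y.2.1)) : ℝ) * Complex.I) ∂ρ) atTop
      (𝓝 (∫ y, Complex.exp (↑(k₁ * y.1 + k₂ * y.2.1 + k₃ * (y.2.2 - y.1 * y.2.1 / 2)) *
        Complex.I) ∂ρ)) := by
  refine tendsto_integral_of_dominated_convergence (fun _ => 1) (fun R => ?_)
    (integrable_const _) (fun R => .of_forall fun y => (Complex.norm_exp_ofReal_mul_I _).le)
    (.of_forall fun y => ?_)
  · exact Measurable.aestronglyMeasurable (by fun_prop)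
  · have hcont : Continuous fun t : ℝ => Complex.exp (t * Complex.I) := by fun_prop
    refine (hcont.tendsto _).comp ?_
    set A := k₁ * y.1 + k₂ * y.2.1 + k₃ * (y.2.2 - y.1 * y.2.1 / 2)
    set B := w₁ * y.1 + w₂ * y.2.1
    have h1 : Tendsto (fun R : ℕ => (R : ℝ) / (R + -B)) atTop (𝓝 1) :=
      tendsto_natCast_div_add_atTop (-B)
    refine (by simpa using h1.const_mul A : Tendsto _ _ (𝓝 A)).congr fun R => ?_
    ring

/-- Two finite measures that do not charge horizontal planes and agree on all double wedges
around horizontal lines are equal. -/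
theorem measure_eq_of_wedge (hμ : ∀ x, μ {y | hForm x y = 0} = 0)
    (hν : ∀ x, ν {y | hForm x y = 0} = 0)
    (h : ∀ x a b, μ (wedge x (lineMap' x a b 1)) = ν (wedge x (lineMap' x a b 1))) : μ = ν := by
  refine expCoord.map_measurableEquiv_injective (Measure.ext_of_charFunDual (funext fun L => ?_))
  obtain ⟨w₁, w₂, hw, hkw⟩ : ∃ w₁ w₂ : ℝ, w₁ ^ 2 + w₂ ^ 2 = 1 ∧
      L (1, 0, 0) * w₁ + L (0, 1, 0) * w₂ = 0 := by
    set p := L (1, 0, 0)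
    set q := L (0, 1, 0)
    by_cases h0 : p ^ 2 + q ^ 2 = 0
    · exact ⟨1, 0, by norm_num, by nlinarith [sq_nonneg p, sq_nonneg q]⟩
    · have hs : 0 < p ^ 2 + q ^ 2 := lt_of_le_of_ne (by positivity) (Ne.symm h0)
      refine ⟨q / √(p ^ 2 + q ^ 2), -p / √(p ^ 2 + q ^ 2), ?_, by ring⟩
      rw [div_pow, div_pow, Real.sq_sqrt hs.le]
      field_simp
      ring
  have hL : ∀ z : Heis, L z = L (1, 0, 0) * z.1 + L (0, 1, 0) * z.2.1 + L (0, 0, 1) * z.2.2 := by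
    intro z
    conv_lhs => rw [show z = z.1 • ((1, 0, 0) : Heis) + z.2.1 • (0, 1, 0) + z.2.2 • (0, 0, 1) by
      ext <;> simp]
    rw [map_add, map_add, map_smul, map_smul, map_smul]
    simp [mul_comm]
  have hchar : ∀ ρ : Measure Heis, charFunDual (ρ.map expCoord) L =
      ∫ y, Complex.exp (↑(L (1, 0, 0) * y.1 + L (0, 1, 0) * y.2.1 +
        L (0, 0, 1) * (y.2.2 - y.1 * y.2.1 / 2)) * Complex.I) ∂ρ := fun ρ => by
    rw [charFunDual_apply, integral_map_equiv]
    refine integral_congr_ae (.of_forall fun y => ?_)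
    simp only [hL (expCoord y)]
    rfl
  rw [hchar, hchar]
  refine tendsto_nhds_unique (tendsto_integral_projective_phase _ _ _ w₁ w₂)
    ((tendsto_integral_projective_phase _ _ _ w₁ w₂).congr fun R => ?_)
  exact (integral_projective_phase_eq hμ hν h _ _ _ w₁ w₂ hw hkw R).symm

end Uniqueness

/-- Injectivity for horizontal cut measures: if a Lipschitz signed measure on `H`
(regarded as a signed measure on horizontal planes via `x ↔ P_x`) satisfies
`Σ(P_{x₁,x₂}) = 0` for a.e. parametrized horizontal pair, then `Σ = 0`. -/
theorem statement18 (σ : MeasureTheory.SignedMeasure Heis) (C : ℝ)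
    (hLip : ∀ (g : Heis) (a b s t : ℝ), ¬(a = 0 ∧ b = 0) →
      σ.totalVariation (Pbetween g a b s t) ≤
        ENNReal.ofReal (C * ccDist (lineMap' g a b s) (lineMap' g a b t)))
    (hvan : ∀ᵐ x ∂(volume : Measure (Heis × (ℝ × ℝ) × ℝ × ℝ)),
      σ (Pbetween x.1 x.2.1.1 x.2.1.2 x.2.2.1 x.2.2.2) = 0) :
    σ = 0 := by
  have htv : ∀ x, σ.totalVariation {y | hForm x y = 0} = 0 :=
    measure_hForm_eq_zero_of_lipschitz C hLip
  set μ := σ.toJordanDecomposition.posPart with hμ_def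
  set ν := σ.toJordanDecomposition.negPart with hν_def
  have htv' : σ.totalVariation = μ + ν := rfl
  have hμ : ∀ x, μ {y | hForm x y = 0} = 0 := fun x =>
    le_antisymm ((le_self_add).trans_eq (by simpa [htv'] using htv x)) bot_le
  have hν : ∀ x, ν {y | hForm x y = 0} = 0 := fun x =>
    le_antisymm ((le_add_self).trans_eq (by simpa [htv'] using htv x)) bot_le
  have hline : Continuous fun x : Heis × (ℝ × ℝ) × ℝ × ℝ =>
      (lineMap' x.1 x.2.1.1 x.2.1.2 x.2.2.1, lineMap' x.1 x.2.1.1 x.2.1.2 x.2.2.2) := by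
    unfold lineMap' hMul
    fun_prop
  have hopen2 : (volume : Measure (ℝ × ℝ)).IsOpenPosMeasure :=
    inferInstanceAs ((volume : Measure ℝ).prod (volume : Measure ℝ)).IsOpenPosMeasure
  have hopen3 : (volume : Measure Heis).IsOpenPosMeasure :=
    inferInstanceAs ((volume : Measure ℝ).prod (volume : Measure (ℝ × ℝ))).IsOpenPosMeasure
  have hopen4 : (volume : Measure ((ℝ × ℝ) × ℝ × ℝ)).IsOpenPosMeasure :=
    inferInstanceAs ((volume : Measure (ℝ × ℝ)).prod (volume : Measure (ℝ × ℝ))).IsOpenPosMeasure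
  have hopen7 : (volume : Measure (Heis × (ℝ × ℝ) × ℝ × ℝ)).IsOpenPosMeasure :=
    inferInstanceAs ((volume : Measure Heis).prod
      (volume : Measure ((ℝ × ℝ) × ℝ × ℝ))).IsOpenPosMeasure
  have hall := (Continuous.ae_eq_iff_eq volume ((continuous_measureReal_wedge hμ).comp hline)
    ((continuous_measureReal_wedge hν).comp hline)).1 (by
      filter_upwards [hvan] with x hx
      by_cases hst : x.2.2.1 = x.2.2.2
      · simp [hst, wedge, (mul_self_nonneg _).not_gt]
      have hm := measurableSet_Pbetween x.1 x.2.1.1 x.2.1.2 x.2.2.1 x.2.2.2 hst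
      rw [σ.apply_eq_posPart_real_sub_negPart_real hm, ← hμ_def, ← hν_def, measureReal_def,
        measureReal_def, measure_Pbetween hμ _ _ _ _ _ hst, measure_Pbetween hν _ _ _ _ _ hst] at hx
      exact sub_eq_zero.1 hx)
  have hw : ∀ x a b, μ (wedge x (lineMap' x a b 1)) = ν (wedge x (lineMap' x a b 1)) := by
    intro x a b
    have := congrFun hall (x, (a, b), 0, 1)
    have hx : lineMap' x a b 0 = x := by ext <;> simp [lineMap', hMul]
    simp only [Function.comp, hx] at this
    exact (ENNReal.toReal_eq_toReal_iff' (measure_ne_top _ _) (measure_ne_top _ _)).1 this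
  have hμν : μ = ν := measure_eq_of_wedge hμ hν hw
  ext i hi
  rw [σ.apply_eq_posPart_real_sub_negPart_real hi, ← hμ_def, ← hν_def, hμν]
  simp
end
end

section
/- Let μ be a finite signed Borel measure on ℝ/πℤ (the real projective line ℝP¹, parametrizing directions in ℝ²). If the convolution of μ with the function θ ↦ |sin θ| vanishes identically — that is, ∫_{ℝ/πℤ} |sin(θ − φ)| dμ(φ) = 0 for every θ ∈ ℝ — then μ = 0. In other words, the linear map μ ↦ μ ∗ |sin| on finite signed Borel measures on ℝ/πℤ is injective. -/
open MeasureTheory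

noncomputable section

/-- `θ ↦ |sin θ|`, descended to the circle `ℝ/πℤ ≅ ℝP¹`. -/
def sinAbsC : AddCircle Real.pi → ℝ :=
  Function.Periodic.lift (f := fun t : ℝ => |Real.sin t|)
    (fun t => by simp [Real.sin_add_pi])

theorem sinAbsC_coe (t : ℝ) : sinAbsC (t : AddCircle Real.pi) = |Real.sin t| :=
  Function.Periodic.lift_coe _ t

theorem continuous_sinAbsC : Continuous sinAbsC :=
  continuous_coinduced_dom.mpr (Real.continuous_sin.abs)

instance fact_pi_pos : Fact (0 < Real.pi) := ⟨Real.pi_pos⟩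

theorem one_sub_four_mul_sq_ne_zero (n : ℤ) : (1 - 4 * (n : ℂ) ^ 2) ≠ 0 := by
  have h : (1 - 4 * n ^ 2 : ℤ) ≠ 0 := by lia
  exact_mod_cast h

theorem integral_exp_mul_sin (n : ℤ) :
    ∫ t in (0 : ℝ)..Real.pi, Complex.exp (2 * Complex.I * n * t) * (Real.sin t : ℂ) =
      2 / (1 - 4 * (n : ℂ) ^ 2) := by
  have hne := one_sub_four_mul_sq_ne_zero n
  have hderiv : ∀ t ∈ Set.uIcc 0 Real.pi, HasDerivAt
      (fun t : ℝ => Complex.exp (2 * Complex.I * n * t) *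
        (2 * Complex.I * n * Complex.sin t - Complex.cos t) / (1 - 4 * (n : ℂ) ^ 2))
      (Complex.exp (2 * Complex.I * n * t) * (Real.sin t : ℂ)) t := by
    intro t _
    have hexp : HasDerivAt (fun z : ℂ => Complex.exp (2 * Complex.I * n * z))
        (Complex.exp (2 * Complex.I * n * t) * (2 * Complex.I * n)) (t : ℂ) := by
      simpa using ((hasDerivAt_id (t : ℂ)).const_mul (2 * Complex.I * n)).cexp
    have hprod := ((hexp.mul (((Complex.hasDerivAt_sin t).const_mul (2 * Complex.I * n)).sub
      (Complex.hasDerivAt_cos t))).div_const (1 - 4 * (n : ℂ) ^ 2)).comp_ofReal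
    refine hprod.congr_deriv ?_
    rw [div_eq_iff hne, Complex.ofReal_sin, Pi.sub_apply]
    linear_combination (4 * n ^ 2 * Complex.exp (2 * Complex.I * n * t) * Complex.sin t) *
      Complex.I_sq
  rw [intervalIntegral.integral_eq_sub_of_hasDerivAt hderiv
    (Continuous.intervalIntegrable (by fun_prop) _ _)]
  have hper : Complex.exp (2 * Complex.I * n * Real.pi) = 1 := by
    rw [← Complex.exp_int_mul_two_pi_mul_I n]
    congr 1
    ring
  rw [hper]
  simp
  ring

theorem integral_fourier_mul_sinAbsC (n : ℤ) :
    ∫ x : AddCircle Real.pi, fourier n x * (sinAbsC x : ℂ) = 2 / (1 - 4 * (n : ℂ) ^ 2) := by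
  rw [← AddCircle.intervalIntegral_preimage Real.pi 0, zero_add, ← integral_exp_mul_sin n]
  refine intervalIntegral.integral_congr fun t ht => ?_
  rw [Set.uIcc_of_le Real.pi_pos.le] at ht
  have hπ : (Real.pi : ℂ) ≠ 0 := by exact_mod_cast Real.pi_ne_zero
  simp only [sinAbsC_coe, fourier_coe_apply, abs_of_nonneg (Real.sin_nonneg_of_mem_Icc ht)]
  congr 2
  field_simp

/-- The Fourier coefficients of `ν ∗ |sin|` are those of `ν` times those of `|sin|`. -/
theorem integral_fourier_mul_convolution_sinAbsC (ν : Measure (AddCircle Real.pi))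
    [IsFiniteMeasure ν] (n : ℤ) :
    ∫ θ : AddCircle Real.pi, fourier n θ * ((∫ φ, sinAbsC (θ - φ) ∂ν : ℝ) : ℂ) =
      2 / (1 - 4 * (n : ℂ) ^ 2) * ∫ φ, fourier n φ ∂ν := by
  have hcont : Continuous (Function.uncurry fun θ φ : AddCircle Real.pi =>
      fourier n θ * (sinAbsC (θ - φ) : ℂ)) := by
    have := continuous_sinAbsC
    have := (fourier (T := Real.pi) n).continuous
    unfold Function.uncurry
    fun_prop
  have hint : Integrable (Function.uncurry fun θ φ : AddCircle Real.pi =>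
      fourier n θ * (sinAbsC (θ - φ) : ℂ)) (volume.prod ν) :=
    hcont.integrable_of_hasCompactSupport (HasCompactSupport.of_compactSpace _)
  calc
    _ = ∫ θ : AddCircle Real.pi, ∫ φ, fourier n θ * (sinAbsC (θ - φ) : ℂ) ∂ν := by
      simp only [integral_const_mul, integral_complex_ofReal]
    _ = ∫ φ, (∫ θ : AddCircle Real.pi, fourier n θ * (sinAbsC (θ - φ) : ℂ)) ∂ν :=
      integral_integral_swap hint
    _ = ∫ φ, 2 / (1 - 4 * (n : ℂ) ^ 2) * fourier n φ ∂ν := by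
      refine integral_congr_ae (.of_forall fun φ => ?_)
      dsimp only
      rw [← integral_add_right_eq_self _ φ, ← integral_fourier_mul_sinAbsC n,
        ← integral_mul_const]
      refine integral_congr_ae (.of_forall fun θ => ?_)
      simp only [add_sub_cancel_right, fourier_apply, zsmul_add, AddCircle.toCircle_add,
        Circle.coe_mul]
      ring
    _ = _ := integral_const_mul _ _

/-- Integration of continuous functions against a finite measure on a compact space. -/
def integralContinuousMap {X : Type*} [TopologicalSpace X] [CompactSpace X] [MeasurableSpace X]
    [BorelSpace X] (ν : Measure X) [IsFiniteMeasure ν] : C(X, ℂ) →L[ℂ] ℂ :=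
  LinearMap.mkContinuous
    { toFun := fun f => ∫ x, f x ∂ν
      map_add' := fun f g => integral_add
        (f.continuous.integrable_of_hasCompactSupport (HasCompactSupport.of_compactSpace _))
        (g.continuous.integrable_of_hasCompactSupport (HasCompactSupport.of_compactSpace _))
      map_smul' := fun c f => integral_const_mul c f }
    (ν.real Set.univ)
    fun f => by
      rw [mul_comm]
      exact norm_integral_le_of_norm_le_const (.of_forall f.norm_coe_le_norm)

/-- A finite measure on the circle is determined by its Fourier coefficients. -/
theorem ext_of_integral_fourier_eq {T : ℝ} [Fact (0 < T)] {P N : Measure (AddCircle T)}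
    [IsFiniteMeasure P] [IsFiniteMeasure N]
    (h : ∀ n : ℤ, ∫ φ, fourier n φ ∂P = ∫ φ, fourier n φ ∂N) : P = N := by
  have hCLM : integralContinuousMap P = integralContinuousMap N := by
    refine ContinuousLinearMap.ext_on (s := Set.range (@fourier T)) ?_ ?_
    · exact (Submodule.dense_iff_topologicalClosure_eq_top).mpr span_fourier_closure_eq_top
    · rintro _ ⟨n, rfl⟩
      exact h n
  refine ext_of_forall_integral_eq_of_IsFiniteMeasure fun f => ?_
  have hf : ∫ x, (f x : ℂ) ∂P = ∫ x, (f x : ℂ) ∂N :=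
    DFunLike.congr_fun hCLM ⟨fun x => (f x : ℂ), by fun_prop⟩
  rw [integral_complex_ofReal, integral_complex_ofReal] at hf
  exact_mod_cast hf

/-- If a finite signed Borel measure `μ` on `ℝ/πℤ` satisfies `(μ ∗ |sin|)(θ) = 0`
for every `θ`, then `μ = 0`: convolution with `|sin|` is injective on finite signed
measures on `ℝP¹`. -/
theorem statement19 (μ : MeasureTheory.SignedMeasure (AddCircle Real.pi))
    (h : ∀ θ : AddCircle Real.pi,
      ∫ φ, sinAbsC (θ - φ) ∂μ.toJordanDecomposition.posPart =
      ∫ φ, sinAbsC (θ - φ) ∂μ.toJordanDecomposition.negPart) :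
    μ = 0 := by
  have hparts : μ.toJordanDecomposition.posPart = μ.toJordanDecomposition.negPart := by
    refine ext_of_integral_fourier_eq fun n => ?_
    refine mul_left_cancel₀ (div_ne_zero two_ne_zero (one_sub_four_mul_sq_ne_zero n)) ?_
    simp only [← integral_fourier_mul_convolution_sinAbsC, h]
  rw [← μ.toSignedMeasure_toJordanDecomposition, JordanDecomposition.toSignedMeasure]
  simp only [hparts, sub_self]
end
end
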